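/- For any γ > 0, any μ ∈ M_{γ/8}, and any bounded Borel functions ξ, ζ : Δ → ℝ, the time correlations decay polynomially: lim_{t→∞} t^{2−γ} · | ∫_Δ (P^t ζ)(x) ξ(x) μ(dx) − ∫_Δ (P^t ζ)(x) μ(dx) · ∫_Δ ξ(x) μ(dx) | = 0. -/

import Mathlib

open MeasureTheory Set Filter

noncomputable section

/-- The open set `U ⊂ ℝ^m` with which the open simplex `Δ` is identified
(via `y = Ē - ∑ i, x i`). -/
def simU (m : ℕ) (E : ℝ) : Set (Fin m → ℝ) := {x | (∀ i, 0 < x i) ∧ ∑ i, x i < E}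

/-- The state space `Δ`. -/
abbrev Delta (m : ℕ) (E : ℝ) : Type := ↥(simU m E)

/-- The tank energy `y = Ē - ∑ i, x i`. -/
def tank (m : ℕ) (E : ℝ) (x : Delta m E) : ℝ := E - ∑ i, x.1 i

/-- The energy exchange map on the ambient space: particle `i` gets energy
`y + (1-u²) x^i`, and the new tank energy is `u² x^i`. -/
def T0 (m : ℕ) (E : ℝ) (i : Fin m) (u : ℝ) (x : Fin m → ℝ) : Fin m → ℝ :=
  Function.update x i ((E - ∑ j, x j) + (1 - u ^ 2) * x i)

lemma T0_mem {m : ℕ} {E : ℝ} {i : Fin m} {u : ℝ} {x : Fin m → ℝ}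
    (hx : x ∈ simU m E) (hu : u ∈ Ioo (0:ℝ) 1) : T0 m E i u x ∈ simU m E := by
  obtain ⟨hpos, hsum⟩ := hx
  obtain ⟨hu0, hu1⟩ := hu
  have hy : 0 < E - ∑ j, x j := sub_pos.mpr hsum
  have hu2 : 0 < 1 - u ^ 2 := by nlinarith
  have hxi := hpos i
  constructor
  · intro j
    rcases eq_or_ne j i with rfl | hj
    · simp only [T0, Function.update_self]
      nlinarith
    · simpa [T0, Function.update_of_ne hj] using hpos j
  · have h1 : ∑ j, T0 m E i u x j
        = ((E - ∑ j, x j) + (1 - u ^ 2) * x i) + ∑ j ∈ Finset.univ \ {i}, x j := by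
      simp only [T0]
      rw [Finset.sum_update_of_mem (Finset.mem_univ i)]
    have h2 : ∑ j ∈ Finset.univ \ {i}, x j = (∑ j, x j) - x i := by
      rw [← Finset.erase_eq]
      exact Finset.sum_erase_eq_sub (Finset.mem_univ i)
    rw [h1, h2]
    nlinarith [mul_pos (mul_pos hu0 hu0) hxi]

/-- The energy exchange map `T_{i,u} : Δ → Δ` (defined to be the identity for
`u ∉ (0,1)`, which is a probability-zero event). -/
def Texch (m : ℕ) (E : ℝ) (i : Fin m) (u : ℝ) (x : Delta m E) : Delta m E :=
  if hu : u ∈ Ioo (0:ℝ) 1 then ⟨T0 m E i u x.1, T0_mem x.2 hu⟩ else x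

/-- The uniform distribution on `(0,1)`. -/
def unif01 : Measure ℝ := volume.restrict (Ioo (0:ℝ) 1)

/-- The uniformization constant `Λ = √(m Ē)`, an upper bound for the total jump rate. -/
def Lam (m : ℕ) (E : ℝ) : ℝ := Real.sqrt (m * E)

/-- The total jump rate `∑ i, √(x^i)`. -/
def jumpRate (m : ℕ) (E : ℝ) (x : Delta m E) : ℝ := ∑ i, Real.sqrt (x.1 i)

/-- One step of the uniformized embedded chain: with probability `1 - r(x)/Λ` stay put,
and with probability `√(x^i)/Λ` particle `i` exchanges energy with the tank, with
`u` drawn uniformly from `(0,1)`. -/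
def ustep (m : ℕ) (E : ℝ) (x : Delta m E) : Measure (Delta m E) :=
  ENNReal.ofReal (1 - jumpRate m E x / Lam m E) • Measure.dirac x
  + (ENNReal.ofReal (Lam m E))⁻¹ •
      Measure.sum (fun i : Fin m =>
        ENNReal.ofReal (Real.sqrt (x.1 i)) • Measure.map (fun u => Texch m E i u x) unif01)

/-- `n`-fold iterate of the uniformized chain. -/
def ustepIter (m : ℕ) (E : ℝ) : ℕ → Delta m E → Measure (Delta m E)
  | 0 => fun x => Measure.dirac x
  | (n+1) => fun x => (ustep m E x).bind (ustepIter m E n)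

/-- The transition probabilities `P^t(x, ·)` of the energy-exchange jump process,
constructed by uniformization: `P^t = ∑ₙ e^{-Λt} (Λt)ⁿ/n! Kⁿ`. -/
def Pt (m : ℕ) (E : ℝ) (t : ℝ) (x : Delta m E) : Measure (Delta m E) :=
  Measure.sum (fun n : ℕ =>
    ENNReal.ofReal (Real.exp (-(Lam m E) * t) * ((Lam m E) * t) ^ n / n.factorial) •
      ustepIter m E n x)

/-- Lebesgue measure on `Δ ≅ U`. -/
def lebU (m : ℕ) (E : ℝ) : Measure (Delta m E) := Measure.comap Subtype.val volume

/-- The (unnormalized) measure with density `y^{-1/2}` w.r.t. Lebesgue measure on `U`. -/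
def piPre (m : ℕ) (E : ℝ) : Measure (Delta m E) :=
  (lebU m E).withDensity (fun x => ENNReal.ofReal ((tank m E x) ^ (-(1/2) : ℝ)))

/-- The invariant probability measure `π`, with density `Z⁻¹ y^{-1/2}`. -/
def piMeasure (m : ℕ) (E : ℝ) : Measure (Delta m E) :=
  (piPre m E Set.univ)⁻¹ • piPre m E

/-- Total variation distance between two (finite) measures:
`sup_A |μ(A) - ν(A)|`. -/
def tvDist {X : Type*} [MeasurableSpace X] (μ ν : Measure X) : ℝ :=
  ⨆ A : {A : Set X // MeasurableSet A}, |(μ A.1).toReal - (ν A.1).toReal|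

end

/-- Membership in the class `M_δ` of Borel probability measures `μ` on `Δ` with
`∫ (∑_k (x^k)^{2δ-1} + y^{δ-1/2}) dμ < ∞`. -/
def memM (m : ℕ) (E : ℝ) (δ : ℝ) (μ : Measure (Delta m E)) : Prop :=
  IsProbabilityMeasure μ ∧
  ∫⁻ x, ENNReal.ofReal (∑ k, (x.1 k) ^ (2*δ - 1) + (tank m E x) ^ (δ - 1/2)) ∂μ ≠ ⊤


section abstractDecay
open ProbabilityTheory

lemma aux_center {X : Type*} (f h : X → ℝ) (H : ∀ x y, |f x - f y| ≤ h x + h y) :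
    ∃ c : ℝ, ∀ x, |f x - c| ≤ h x := by
  rcases isEmpty_or_nonempty X with hX | hX
  · exact ⟨0, fun x => (hX.false x).elim⟩
  · have key : ∀ x y, f x - h x ≤ f y + h y := fun x y => by
      have := (abs_le.1 (H x y)).2; linarith
    have hbdd : BddBelow (range fun y => f y + h y) := by
      obtain ⟨x0⟩ := hX
      exact ⟨f x0 - h x0, by rintro _ ⟨y, rfl⟩; exact key x0 y⟩
    refine ⟨⨅ y, (f y + h y), fun x => ?_⟩
    have h1 : f x - h x ≤ ⨅ y, (f y + h y) := le_ciInf (key x)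
    have h2 : (⨅ y, (f y + h y)) ≤ f x + h x := ciInf_le hbdd x
    rw [abs_le]; constructor <;> linarith

lemma aux_integrable {X : Type*} [MeasurableSpace X] (μ : Measure X) [IsFiniteMeasure μ]
    (f : X → ℝ) (hf : Measurable f) (M : ℝ) (hM : ∀ x, |f x| ≤ M) : Integrable f μ :=
  Integrable.of_bound hf.aestronglyMeasurable M (Eventually.of_forall hM)

lemma aux_contract {X : Type*} [MeasurableSpace X] (f V : X → ℝ) (hf : Measurable f)
    (M : ℝ) (hM : ∀ x, |f x| ≤ M) (hV : ∀ x, 0 ≤ V x) (a B ε : ℝ) (ha : 0 ≤ a) (hB : 0 ≤ B)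
    (H : ∀ x y, |f x - f y| ≤ a * (V x + V y + B)) (μ₁ μ₂ ν : Measure X)
    [IsProbabilityMeasure μ₁] [IsProbabilityMeasure μ₂]
    (h1 : ν ≤ μ₁) (h2 : ν ≤ μ₂) (hε : ε ≤ (ν univ).toReal) (i1 : Integrable V μ₁)
    (i2 : Integrable V μ₂) :
    |∫ x, f x ∂μ₁ - ∫ x, f x ∂μ₂| ≤ a * (∫ x, V x ∂μ₁ + ∫ x, V x ∂μ₂ + B * (1 - ε)) := by
  obtain ⟨c, hc⟩ := aux_center f (fun x => a * (V x + B / 2))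
    (fun x y => (H x y).trans (le_of_eq (by ring)))
  have key : ∀ μ : Measure X, IsProbabilityMeasure μ → ν ≤ μ → Integrable V μ →
      ∃ e : ℝ, ∫ x, f x ∂μ = c + (∫ x, (f x - c) ∂ν) + e ∧
        |e| ≤ a * (∫ x, V x ∂μ + B / 2 * (1 - ε)) := by
    intro μ hμ hν hi
    have : IsFiniteMeasure ν := isFiniteMeasure_of_le μ hν
    have hif : Integrable f μ := aux_integrable μ f hf M hM
    have hsub : μ - ν + ν = μ := Measure.sub_add_cancel_of_le hν
    have hle : μ - ν ≤ μ := Measure.sub_le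
    have : IsFiniteMeasure (μ - ν) := isFiniteMeasure_of_le μ hle
    have hifc : Integrable (fun x => f x - c) μ := hif.sub (integrable_const c)
    refine ⟨∫ x, (f x - c) ∂(μ - ν), ?_, ?_⟩
    · have e1 : ∫ x, (f x - c) ∂μ = ∫ x, (f x - c) ∂(μ - ν) + ∫ x, (f x - c) ∂ν := by
        conv_lhs => rw [← hsub]
        exact integral_add_measure (hifc.mono_measure hle) (hifc.mono_measure hν)
      have e2 : ∫ x, (f x - c) ∂μ = ∫ x, f x ∂μ - c := by
        rw [integral_sub hif (integrable_const c)]; simp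
      linarith
    · have hmass : ((μ - ν) univ).toReal ≤ 1 - ε := by
        have : (μ univ) = (μ - ν) univ + ν univ := by
          conv_lhs => rw [← hsub]
          rfl
        rw [measure_univ] at this
        have := congrArg ENNReal.toReal this
        rw [ENNReal.toReal_add (measure_ne_top _ _) (measure_ne_top _ _)] at this
        simp only [ENNReal.toReal_one] at this
        linarith
      have hVle : ∫ x, V x ∂(μ - ν) ≤ ∫ x, V x ∂μ :=
        integral_mono_measure hle (Eventually.of_forall hV) hi
      have hih : Integrable (fun x => a * (V x + B / 2)) (μ - ν) :=
        ((hi.mono_measure hle).add (integrable_const _)).const_mul a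
      calc |∫ x, (f x - c) ∂(μ - ν)| ≤ ∫ x, |f x - c| ∂(μ - ν) := abs_integral_le_integral_abs
        _ ≤ ∫ x, a * (V x + B / 2) ∂(μ - ν) :=
            integral_mono (hifc.mono_measure hle).abs hih hc
        _ = a * (∫ x, V x ∂(μ - ν) + ((μ - ν) univ).toReal * (B / 2)) := by
            rw [integral_const_mul, integral_add (hi.mono_measure hle) (integrable_const _),
              integral_const, smul_eq_mul, measureReal_def]
        _ ≤ _ := by
            apply mul_le_mul_of_nonneg_left _ ha
            nlinarith
  obtain ⟨e1, he1, hb1⟩ := key μ₁ inferInstance h1 i1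
  obtain ⟨e2, he2, hb2⟩ := key μ₂ inferInstance h2 i2
  rw [he1, he2]
  have : c + ∫ x, (f x - c) ∂ν + e1 - (c + ∫ x, (f x - c) ∂ν + e2) = e1 - e2 := by ring
  rw [this]
  calc |e1 - e2| ≤ |e1| + |e2| := abs_sub e1 e2
    _ ≤ _ := by linarith

lemma aux_iter {X : Type*} [MeasurableSpace X] (P : ℕ → Kernel X X) [∀ n, IsMarkovKernel (P n)]
    (hP : ∀ a n, P (a + n) = P n ∘ₖ P a) (V : X → ℝ) (hV : ∀ x, 0 ≤ V x) (hVm : Measurable V)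
    (b : ℝ) (hint : ∀ x, Integrable V (P 1 x)) (hdrift : ∀ x, ∫ z, V z ∂P 1 x ≤ V x + b)
    (N : ℕ) (hN : 1 ≤ N) :
    ∀ x, Integrable V (P N x) ∧ ∫ z, V z ∂P N x ≤ V x + N * b := by
  induction N, hN using Nat.le_induction with
  | base => intro x; exact ⟨hint x, by simpa using hdrift x⟩
  | succ N hN ih =>
    intro x
    obtain ⟨i1, i2⟩ := ih x
    have hm : Measurable fun y => ∫ z, V z ∂P 1 y :=
      (hVm.stronglyMeasurable.integral_kernel (κ := P 1)).measurable
    have hi : Integrable (fun y => ∫ z, V z ∂P 1 y) (P N x) := by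
      refine Integrable.mono' (i1.add (integrable_const b)) hm.aestronglyMeasurable
        (Eventually.of_forall fun y => ?_)
      rw [Real.norm_of_nonneg (integral_nonneg hV)]
      exact hdrift y
    have hI : Integrable V (P (N + 1) x) := by
      rw [hP N 1, ProbabilityTheory.integrable_comp_iff hVm.aestronglyMeasurable]
      refine ⟨Eventually.of_forall hint, ?_⟩
      have : (fun x => ‖V x‖) = V := by
        funext x; exact Real.norm_of_nonneg (hV x)
      simp only [Real.norm_of_nonneg (hV _)]
      exact hi
    refine ⟨hI, ?_⟩
    have hI' := hI
    rw [hP N 1] at hI' ⊢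
    rw [Kernel.integral_comp hI']
    calc ∫ y, ∫ z, V z ∂P 1 y ∂P N x ≤ ∫ y, (V y + b) ∂P N x :=
          integral_mono hi (i1.add (integrable_const b)) hdrift
      _ = ∫ y, V y ∂P N x + b := by
          rw [integral_add i1 (integrable_const b)]; simp
      _ ≤ _ := by push_cast; linarith

lemma aux_bern (t p : ℝ) (h0 : 0 ≤ t) (h1 : t < 1) (hp : p ≤ 2) : 1 - 2 * t ≤ (1 - t) ^ p := by
  have : (1 - t) ^ (2 : ℝ) ≤ (1 - t) ^ p :=
    Real.rpow_le_rpow_of_exponent_ge (by linarith) (by linarith) hp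
  have h2 : (1 - t) ^ (2 : ℝ) = (1 - t) ^ 2 := Real.rpow_two _
  rw [h2] at this
  nlinarith [sq_nonneg t]

/-- `(1-s) (k-j)^{-p} ≤ k^{-p}` as soon as `2 j / k ≤ s`. -/
lemma aux_ratio (k j s p : ℝ) (hj : 0 ≤ j) (hk : j < k) (hp : p ≤ 2)
    (hs : 2 * (j / k) ≤ s) : (k - j) ^ (-p) * (1 - s) ≤ k ^ (-p) := by
  have hk0 : 0 < k := by linarith
  have hkj : 0 < k - j := by linarith
  have h := aux_bern (j / k) p (by positivity) ((div_lt_one hk0).2 hk) hp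
  have e : 1 - j / k = (k - j) / k := by field_simp
  rw [e, Real.div_rpow hkj.le hk0.le] at h
  rw [Real.rpow_neg hkj.le, Real.rpow_neg hk0.le]
  have a1 : 0 < (k - j) ^ p := by positivity
  have a2 : 0 < k ^ p := by positivity
  have h' : 1 - s ≤ (k - j) ^ p / k ^ p := by linarith
  calc ((k - j) ^ p)⁻¹ * (1 - s) ≤ ((k - j) ^ p)⁻¹ * ((k - j) ^ p / k ^ p) := by gcongr
    _ = _ := by field_simp

set_option maxHeartbeats 1600000 in
theorem abs_decay {X : Type*} [MeasurableSpace X] (P : ℕ → Kernel X X)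
    [∀ n, IsMarkovKernel (P n)]
    (hP : ∀ a n, P (a + n) = P n ∘ₖ P a) (V : X → ℝ) (hV : ∀ x, 0 ≤ V x) (hVm : Measurable V)
    (q c b : ℝ) (hq : 1 / 2 ≤ q) (hq1 : q < 1) (hc : 0 < c) (hb : 0 ≤ b)
    (hint : ∀ x, Integrable V (P 1 x))
    (hdrift : ∀ x, ∫ z, V z ∂P 1 x ≤ V x - c * V x ^ (1 - q) + b)
    (hmin : ∀ R : ℝ, ∃ N : ℕ, 1 ≤ N ∧ ∃ ν : Measure X, ∃ ε : ℝ, 0 < ε ∧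
      ∀ x, V x ≤ R → ν ≤ P N x ∧ ε ≤ (ν univ).toReal) :
    ∃ A B : ℝ, 0 < A ∧ 0 ≤ B ∧ ∀ ζ : X → ℝ, Measurable ζ → (∀ x, |ζ x| ≤ 1) → ∀ (n : ℕ) (x y : X),
      |∫ z, ζ z ∂P n x - ∫ z, ζ z ∂P n y| ≤ A * (V x + V y + B) * ((n : ℝ) + 1) ^ (-(1 / q)) := by
  have hq0 : 0 < q := by linarith
  set p := 1 / q with hp
  have hp2 : p ≤ 2 := by rw [hp, div_le_iff₀ hq0]; linarith
  have hp0 : 0 < p := by positivity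
  set R : ℝ := 2 * (4 * b / c) ^ (1 / (1 - q)) + 1 with hR
  have hR1 : 1 ≤ R := by
    have : 0 ≤ (4 * b / c) ^ (1 / (1 - q)) := by positivity
    linarith
  obtain ⟨N, hN, ν, ε₀, hε₀, hν⟩ := hmin R
  set ε := min ε₀ 1 with hε
  have hεpos : 0 < ε := lt_min hε₀ one_pos
  have hε1 : ε ≤ 1 := min_le_right _ _
  have hεε : ε ≤ ε₀ := min_le_left _ _
  have hNr : (1 : ℝ) ≤ N := by exact_mod_cast hN
  set B : ℝ := 2 * (R + 2 * N * b) / ε + 1 with hBdef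
  have hB1 : 1 ≤ B := by
    have : 0 ≤ 2 * (R + 2 * N * b) / ε := by positivity
    linarith
  have hBε : R + 2 * N * b ≤ ε * B / 2 := by
    have : ε * B = 2 * (R + 2 * N * b) + ε := by rw [hBdef]; field_simp
    linarith
  set n0 : ℝ := 4 * N / ε with hn0
  have hn0N : 4 * N ≤ n0 := by
    rw [hn0, le_div_iff₀ hεpos]; nlinarith
  have hn01 : 1 ≤ n0 := by linarith
  set c1 : ℝ := c / 2 * (1 / (2 * (1 + B))) ^ (1 - q) with hc1
  have hc1pos : 0 < c1 := by positivity
  set A : ℝ := 2 * (N + n0) ^ p + 2 * (2 / c1) ^ p with hA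
  have hApos : 0 < A := by positivity
  have hit := aux_iter P hP V hV hVm b hint
    (fun x => (hdrift x).trans (by
      have : 0 ≤ c * V x ^ (1 - q) := mul_nonneg hc.le (Real.rpow_nonneg (hV x) _)
      linarith))
  refine ⟨A, B, hApos, by linarith, fun ζ hζ hζ1 => ?_⟩
  set f : ℕ → X → ℝ := fun n x => ∫ z, ζ z ∂P n x with hf
  have hfm : ∀ n, Measurable (f n) := fun n =>
    (hζ.stronglyMeasurable.integral_kernel (κ := P n)).measurable
  have hf1 : ∀ n x, |f n x| ≤ 1 := by
    intro n x
    have := norm_integral_le_of_norm_le_const (μ := P n x) (f := ζ) (C := 1)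
      (Eventually.of_forall hζ1)
    simpa using this
  have hfs : ∀ a n x, f (a + n) x = ∫ y, f n y ∂P a x := by
    intro a n x
    simp only [hf]
    rw [hP a n]
    exact Kernel.integral_comp (aux_integrable _ ζ hζ 1 hζ1)
  have main : ∀ n : ℕ, ∀ x y, |f n x - f n y| ≤ A * ((n : ℝ) + n0) ^ (-p) * (V x + V y + B) := by
    intro n
    induction n using Nat.strong_induction_on with
    | _ n ih =>
    intro x y
    set k : ℝ := (n : ℝ) + n0 with hk
    have hkpos : 0 < k := by positivity
    have hW : 0 ≤ V x + V y := add_nonneg (hV x) (hV y)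
    have hD2 : |f n x - f n y| ≤ 2 := by
      calc _ ≤ |f n x| + |f n y| := abs_sub _ _
        _ ≤ 2 := by linarith [hf1 n x, hf1 n y]
    by_cases htriv : 2 ≤ A * k ^ (-p) * (V x + V y + B)
    · exact hD2.trans htriv
    push Not at htriv
    have hnN : N ≤ n := by
      by_contra hlt
      push Not at hlt
      have hkN : k ≤ N + n0 := by
        have : (n : ℝ) ≤ N := by exact_mod_cast hlt.le
        linarith
      have h1 : 2 * k ^ p ≤ A := by
        have : k ^ p ≤ (N + n0) ^ p := Real.rpow_le_rpow hkpos.le hkN hp0.le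
        have h3 : 0 ≤ 2 * (2 / c1) ^ p := by positivity
        linarith
      have h2 : 2 ≤ A * k ^ (-p) := by
        rw [Real.rpow_neg hkpos.le, ← div_eq_mul_inv, le_div_iff₀ (by positivity)]
        exact h1
      nlinarith
    have hnr : (N : ℝ) ≤ n := by exact_mod_cast hnN
    by_cases hC : V x + V y ≤ R
    · -- small set
      obtain ⟨j, rfl⟩ := Nat.exists_eq_add_of_le hnN
      have ihj := ih j (by omega)
      have hx : V x ≤ R := by linarith [hV y]
      have hy : V y ≤ R := by linarith [hV x]
      have hj : (0 : ℝ) ≤ A * ((j : ℝ) + n0) ^ (-p) := by positivity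
      have := aux_contract (f j) V (hfm j) 1 (hf1 j) hV _ B ε hj (by linarith) ihj (P N x) (P N y) ν
        (hν x hx).1 (hν y hy).1 (hεε.trans (hν x hx).2) (hit N hN x).1 (hit N hN y).1
      rw [hfs, hfs]
      refine this.trans ?_
      have e1 : ∫ z, V z ∂P N x + ∫ z, V z ∂P N y + B * (1 - ε) ≤ (1 - ε / 2) * B := by
        have a1 := (hit N hN x).2
        have a2 := (hit N hN y).2
        nlinarith
      have e2 : ((j : ℝ) + n0) ^ (-p) * (1 - ε / 2) ≤ k ^ (-p) := by
        have hkj : (j : ℝ) + n0 = k - N := by rw [hk]; push_cast; ring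
        rw [hkj]
        apply aux_ratio k N (ε / 2) p (by positivity) (by linarith) hp2
        have : 4 * N / ε ≤ k := by rw [hk]; push_cast; linarith
        rw [div_le_iff₀ hεpos] at this
        rw [← mul_div_assoc, div_le_iff₀ hkpos]
        linarith
      calc A * ((j : ℝ) + n0) ^ (-p) * (∫ z, V z ∂P N x + ∫ z, V z ∂P N y + B * (1 - ε))
          ≤ A * ((j : ℝ) + n0) ^ (-p) * ((1 - ε / 2) * B) := by gcongr
        _ = A * (((j : ℝ) + n0) ^ (-p) * (1 - ε / 2)) * B := by ring
        _ ≤ A * k ^ (-p) * B := by gcongr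
        _ ≤ A * k ^ (-p) * (V x + V y + B) := by gcongr; linarith
    · push Not at hC
      obtain ⟨j, rfl⟩ := Nat.exists_eq_add_of_le (hN.trans hnN)
      have ihj := ih j (by omega)
      have hj : (0 : ℝ) ≤ A * ((j : ℝ) + n0) ^ (-p) := by positivity
      have := aux_contract (f j) V (hfm j) 1 (hf1 j) hV _ B 0 hj (by linarith) ihj (P 1 x) (P 1 y) 0
        (Measure.zero_le _) (Measure.zero_le _) (by simp) (hint x) (hint y)
      rw [hfs, hfs]
      refine this.trans ?_
      set W := V x + V y with hWdef
      set H := W + B with hH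
      have hHpos : 0 < H := by linarith
      have hq1' : 0 < 1 - q := by linarith
      -- lower bound on the drift
      have d1 : (W / 2) ^ (1 - q) ≤ V x ^ (1 - q) + V y ^ (1 - q) := by
        rcases le_total (V x) (V y) with h | h
        · have : (W / 2) ^ (1 - q) ≤ V y ^ (1 - q) :=
            Real.rpow_le_rpow (by linarith) (by linarith) hq1'.le
          linarith [Real.rpow_nonneg (hV x) (1 - q)]
        · have : (W / 2) ^ (1 - q) ≤ V x ^ (1 - q) :=
            Real.rpow_le_rpow (by linarith) (by linarith) hq1'.le
          linarith [Real.rpow_nonneg (hV y) (1 - q)]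
      have d2 : 4 * b ≤ c * (W / 2) ^ (1 - q) := by
        have h1 : (4 * b / c) ^ (1 / (1 - q)) ≤ W / 2 := by linarith
        have h2 : ((4 * b / c) ^ (1 / (1 - q))) ^ (1 - q) ≤ (W / 2) ^ (1 - q) :=
          Real.rpow_le_rpow (by positivity) h1 hq1'.le
        rw [← Real.rpow_mul (by positivity), one_div_mul_cancel hq1'.ne', Real.rpow_one,
          div_le_iff₀ hc] at h2
        linarith
      have d3 : c1 * H ^ (1 - q) ≤ c / 2 * (W / 2) ^ (1 - q) := by
        rw [hc1, mul_assoc, ← Real.mul_rpow (by positivity) hHpos.le]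
        gcongr
        rw [one_div_mul_eq_div, div_le_div_iff₀ (by positivity) (by positivity)]
        nlinarith
      have d4 : ∫ z, V z ∂P 1 x + ∫ z, V z ∂P 1 y + B * (1 - 0) ≤ H - c1 * H ^ (1 - q) := by
        have a1 := hdrift x
        have a2 := hdrift y
        nlinarith
      have d5 : H - c1 * H ^ (1 - q) = H * (1 - c1 * H ^ (-q)) := by
        have : H ^ (1 - q) = H * H ^ (-q) := by
          rw [sub_eq_add_neg, Real.rpow_add hHpos, Real.rpow_one]
        rw [this]; ring
      have d6 : 2 * (1 / k) ≤ c1 * H ^ (-q) := by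
        have h1 : A * H < 2 * k ^ p := by
          rw [Real.rpow_neg hkpos.le] at htriv
          have : A * H / k ^ p < 2 := by
            rw [div_eq_mul_inv]; linarith [mul_right_comm A (k ^ p)⁻¹ H]
          rwa [div_lt_iff₀ (by positivity)] at this
        have h2 : 2 * (2 / c1) ^ p * H ≤ A * H := by
          gcongr
          have : 0 ≤ 2 * (N + n0) ^ p := by positivity
          linarith
        have h3 : (2 / c1) ^ p * H ≤ k ^ p := by linarith
        have h4 : ((2 / c1) ^ p * H) ^ q ≤ (k ^ p) ^ q :=
          Real.rpow_le_rpow (by positivity) h3 hq0.le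
        have hpq : p * q = 1 := by rw [hp]; field_simp
        rw [Real.mul_rpow (by positivity) hHpos.le, ← Real.rpow_mul (by positivity),
          ← Real.rpow_mul hkpos.le, hpq, Real.rpow_one, Real.rpow_one] at h4
        rw [Real.rpow_neg hHpos.le, ← div_eq_mul_inv, mul_one_div,
          div_le_div_iff₀ hkpos (by positivity)]
        rw [div_mul_eq_mul_div, div_le_iff₀ hc1pos] at h4
        linarith
      have d7 : ((j : ℝ) + n0) ^ (-p) * (1 - c1 * H ^ (-q)) ≤ k ^ (-p) := by
        have hkj : (j : ℝ) + n0 = k - 1 := by rw [hk]; push_cast; ring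
        rw [hkj]
        exact aux_ratio k 1 _ p zero_le_one (by linarith) hp2 d6
      calc A * ((j : ℝ) + n0) ^ (-p) * (∫ z, V z ∂P 1 x + ∫ z, V z ∂P 1 y + B * (1 - 0))
          ≤ A * ((j : ℝ) + n0) ^ (-p) * (H * (1 - c1 * H ^ (-q))) := by
            rw [← d5]; gcongr
        _ = A * (((j : ℝ) + n0) ^ (-p) * (1 - c1 * H ^ (-q))) * H := by ring
        _ ≤ A * k ^ (-p) * H := by gcongr
  intro n x y
  refine (main n x y).trans ?_
  have : ((n : ℝ) + n0) ^ (-p) ≤ ((n : ℝ) + 1) ^ (-p) :=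
    Real.rpow_le_rpow_of_nonpos (by positivity) (by linarith) (by linarith)
  have hW : 0 ≤ V x + V y + B := by linarith [hV x, hV y]
  calc A * ((n : ℝ) + n0) ^ (-p) * (V x + V y + B) ≤ A * ((n : ℝ) + 1) ^ (-p) * (V x + V y + B) := by
        gcongr
    _ = _ := by ring

end abstractDecay


section kernels
open ProbabilityTheory

lemma simU_meas (m : ℕ) (E : ℝ) : MeasurableSet (simU m E) := by
  have : simU m E = (⋂ i, {x | 0 < x i}) ∩ {x | ∑ i, x i < E} := by
    ext x; simp [simU]
  rw [this]
  refine MeasurableSet.inter (MeasurableSet.iInter fun i => ?_) ?_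
  · exact measurableSet_lt measurable_const (measurable_pi_apply i)
  · exact measurableSet_lt (Finset.measurable_sum _ fun i _ => measurable_pi_apply i)
      measurable_const

lemma tank_pos {m : ℕ} {E : ℝ} (x : Delta m E) : 0 < tank m E x := sub_pos.2 x.2.2

lemma tank_lt {m : ℕ} {E : ℝ} (x : Delta m E) (hm : 1 ≤ m) : tank m E x < E := by
  have : 0 < ∑ i, x.1 i := Finset.sum_pos (fun i _ => x.2.1 i) ⟨⟨0, hm⟩, Finset.mem_univ _⟩
  unfold tank; linarith

lemma x_lt {m : ℕ} {E : ℝ} (x : Delta m E) (i : Fin m) : x.1 i < E :=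
  lt_of_le_of_lt (Finset.single_le_sum (f := x.1) (fun j _ => (x.2.1 j).le) (Finset.mem_univ i)) x.2.2

lemma texch_coe {m : ℕ} {E : ℝ} (i : Fin m) {u : ℝ} (hu : u ∈ Ioo (0:ℝ) 1) (x : Delta m E) :
    (Texch m E i u x).1 = T0 m E i u x.1 := by
  simp only [Texch]; rw [dif_pos hu]

lemma texch_meas (m : ℕ) (E : ℝ) (i : Fin m) :
    Measurable (fun p : Delta m E × ℝ => Texch m E i p.2 p.1) := by
  rw [← (MeasurableEmbedding.subtype_coe (simU_meas m E)).measurable_comp_iff]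
  have h : (Subtype.val ∘ fun p : Delta m E × ℝ => Texch m E i p.2 p.1)
      = fun p : Delta m E × ℝ => if p.2 ∈ Ioo (0:ℝ) 1 then T0 m E i p.2 p.1.1 else p.1.1 := by
    funext p
    by_cases hu : p.2 ∈ Ioo (0:ℝ) 1
    · simp only [Function.comp, Texch]; rw [dif_pos hu, if_pos hu]
    · simp only [Function.comp, Texch]; rw [dif_neg hu, if_neg hu]
  rw [h]
  have hc : Measurable fun p : Delta m E × ℝ => p.1.1 := measurable_subtype_coe.comp measurable_fst
  have hcj : ∀ j, Measurable fun p : Delta m E × ℝ => p.1.1 j :=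
    fun j => (measurable_pi_apply j).comp hc
  refine Measurable.ite (measurable_snd measurableSet_Ioo) ?_ hc
  refine measurable_pi_lambda _ fun j => ?_
  by_cases hj : j = i
  · subst hj
    simp only [T0, Function.update_self]
    have := Finset.measurable_sum Finset.univ (fun j (_ : j ∈ Finset.univ) => hcj j)
    have h2 := hcj j
    fun_prop
  · simp only [T0, Function.update_of_ne hj]
    exact hcj j

lemma texch_meas_u (m : ℕ) (E : ℝ) (i : Fin m) (x : Delta m E) :
    Measurable (fun u => Texch m E i u x) :=
  (texch_meas m E i).comp measurable_prodMk_left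

instance unif01_prob : IsProbabilityMeasure unif01 := ⟨by simp [unif01]⟩

lemma jumpRate_nonneg {m : ℕ} {E : ℝ} (x : Delta m E) : 0 ≤ jumpRate m E x :=
  Finset.sum_nonneg fun _ _ => Real.sqrt_nonneg _

lemma jumpRate_le {m : ℕ} {E : ℝ} (x : Delta m E) : jumpRate m E x ≤ Lam m E := by
  unfold jumpRate Lam
  apply Real.le_sqrt_of_sq_le
  have h := Finset.sum_mul_sq_le_sq_mul_sq Finset.univ (fun _ : Fin m => (1:ℝ))
    (fun i => Real.sqrt (x.1 i))
  simp only [one_mul, one_pow, Finset.sum_const, Finset.card_univ, Fintype.card_fin,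
    nsmul_eq_mul, mul_one] at h
  refine h.trans ?_
  have : ∀ i, Real.sqrt (x.1 i) ^ 2 = x.1 i := fun i => Real.sq_sqrt (x.2.1 i).le
  simp only [this]
  have := x.2.2
  gcongr

lemma Lam_pos {m : ℕ} {E : ℝ} (hm : 1 ≤ m) (hE : 0 < E) : 0 < Lam m E := by
  have : (0:ℝ) < m := by exact_mod_cast hm
  exact Real.sqrt_pos.2 (by positivity)

lemma sqrtx_meas {m : ℕ} {E : ℝ} (i : Fin m) : Measurable fun x : Delta m E => Real.sqrt (x.1 i) :=
  ((measurable_pi_apply i).comp measurable_subtype_coe).sqrt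

lemma jumpRate_meas (m : ℕ) (E : ℝ) : Measurable (jumpRate m E) :=
  Finset.measurable_sum _ fun i _ => sqrtx_meas i

lemma ustep_meas (m : ℕ) (E : ℝ) : Measurable (ustep m E) := by
  refine Measure.measurable_of_measurable_coe _ fun s hs => ?_
  simp only [ustep, Measure.add_apply, Measure.smul_apply, smul_eq_mul, Measure.sum_fintype,
    Measure.finsetSum_apply, Measure.dirac_apply' _ hs]
  refine Measurable.add ?_ ?_
  · refine Measurable.mul ?_ ?_
    · exact ((measurable_const.sub ((jumpRate_meas m E).div_const _))).ennreal_ofReal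
    · exact measurable_one.indicator hs
  · refine Measurable.const_mul ?_ _
    refine Finset.measurable_sum _ fun i _ => ?_
    refine Measurable.mul (sqrtx_meas i).ennreal_ofReal ?_
    have : ∀ x, Measure.map (fun u => Texch m E i u x) unif01 s
        = unif01 (Prod.mk x ⁻¹' ((fun p : Delta m E × ℝ => Texch m E i p.2 p.1) ⁻¹' s)) := by
      intro x
      rw [Measure.map_apply (texch_meas_u m E i x) hs]; rfl
    simp only [this]
    exact measurable_measure_prodMk_left (texch_meas m E i hs)

lemma lintegral_ustep (m : ℕ) (E : ℝ) (x : Delta m E) (f : Delta m E → ENNReal)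
    (hf : Measurable f) :
    ∫⁻ z, f z ∂ustep m E x = ENNReal.ofReal (1 - jumpRate m E x / Lam m E) * f x
      + (ENNReal.ofReal (Lam m E))⁻¹ * ∑ i, ENNReal.ofReal (Real.sqrt (x.1 i)) *
        ∫⁻ u, f (Texch m E i u x) ∂unif01 := by
  simp only [ustep, lintegral_add_measure, lintegral_smul_measure, Measure.sum_fintype,
    lintegral_finsetSum_measure, smul_eq_mul, lintegral_dirac' _ hf]
  congr 2
  refine Finset.sum_congr rfl fun i _ => ?_
  rw [lintegral_map hf (texch_meas_u m E i x)]

lemma ustep_prob {m : ℕ} {E : ℝ} (hm : 1 ≤ m) (hE : 0 < E) (x : Delta m E) :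
    IsProbabilityMeasure (ustep m E x) := by
  constructor
  have h := lintegral_ustep m E x (fun _ => 1) measurable_const
  simp only [lintegral_one, measure_univ, mul_one] at h
  rw [h, ← ENNReal.ofReal_sum_of_nonneg (fun i _ => Real.sqrt_nonneg _),
    ← ENNReal.ofReal_inv_of_pos (Lam_pos hm hE), ← ENNReal.ofReal_mul
      (inv_nonneg.2 (Lam_pos hm hE).le), ← ENNReal.ofReal_add, ← ENNReal.ofReal_one]
  · congr 1
    have := (Lam_pos hm hE).ne'
    change 1 - jumpRate m E x / Lam m E + (Lam m E)⁻¹ * jumpRate m E x = 1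
    field_simp; ring
  · rw [sub_nonneg, div_le_one (Lam_pos hm hE)]; exact jumpRate_le x
  · exact mul_nonneg (inv_nonneg.2 (Lam_pos hm hE).le) (jumpRate_nonneg x)

lemma ustepIter_meas (m : ℕ) (E : ℝ) (n : ℕ) : Measurable (ustepIter m E n) := by
  induction n with
  | zero => exact Measure.measurable_dirac
  | succ n ih => exact (Measure.measurable_bind' ih).comp (ustep_meas m E)

lemma ustepIter_prob {m : ℕ} {E : ℝ} (hm : 1 ≤ m) (hE : 0 < E) (n : ℕ) (x : Delta m E) :
    IsProbabilityMeasure (ustepIter m E n x) := by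
  induction n generalizing x with
  | zero => exact Measure.dirac.isProbabilityMeasure
  | succ n ih =>
    constructor
    have := ustep_prob hm hE x
    change (ustep m E x).bind (ustepIter m E n) univ = 1
    rw [Measure.bind_apply MeasurableSet.univ (ustepIter_meas m E n).aemeasurable]
    simp [fun y => (ih y).measure_univ]

/-- iterated kernels -/
noncomputable def Kn (m : ℕ) (E : ℝ) (n : ℕ) : Kernel (Delta m E) (Delta m E) :=
  ⟨ustepIter m E n, ustepIter_meas m E n⟩

lemma Kn_markov {m : ℕ} {E : ℝ} (hm : 1 ≤ m) (hE : 0 < E) (n : ℕ) : IsMarkovKernel (Kn m E n) :=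
  ⟨fun x => ustepIter_prob hm hE n x⟩

lemma ustepIter_add (m : ℕ) (E : ℝ) (a n : ℕ) (x : Delta m E) :
    ustepIter m E (a + n) x = (ustepIter m E a x).bind (ustepIter m E n) := by
  induction a generalizing x with
  | zero =>
    rw [Nat.zero_add]
    exact (Measure.dirac_bind (ustepIter_meas m E n) x).symm
  | succ a ih =>
    rw [Nat.succ_add]
    change (ustep m E x).bind (ustepIter m E (a + n)) =
      ((ustep m E x).bind (ustepIter m E a)).bind (ustepIter m E n)
    rw [Measure.bind_bind (ustepIter_meas m E a).aemeasurable (ustepIter_meas m E n).aemeasurable]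
    congr 1
    funext y
    exact ih y

lemma Kn_add (m : ℕ) (E : ℝ) (a n : ℕ) : Kn m E (a + n) = Kn m E n ∘ₖ Kn m E a := by
  ext1 x
  rw [Kernel.comp_apply]
  exact ustepIter_add m E a n x

lemma ustepIter_one (m : ℕ) (E : ℝ) (x : Delta m E) : ustepIter m E 1 x = ustep m E x :=
  Measure.bind_dirac

lemma lintegral_succ (m : ℕ) (E : ℝ) (n : ℕ) (x : Delta m E) (f : Delta m E → ENNReal)
    (hf : Measurable f) :
    ∫⁻ z, f z ∂ustepIter m E (n + 1) x = ∫⁻ y, ∫⁻ z, f z ∂ustepIter m E n y ∂ustep m E x :=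
  Measure.lintegral_bind (ustepIter_meas m E n).aemeasurable hf.aemeasurable

lemma lintegral_meas (m : ℕ) (E : ℝ) (n : ℕ) (f : Delta m E → ENNReal)
    (hf : Measurable f) : Measurable fun x => ∫⁻ z, f z ∂ustepIter m E n x :=
  (Measure.measurable_lintegral hf).comp (ustepIter_meas m E n)

end kernels


section minorization
open ProbabilityTheory

noncomputable def cst (m : ℕ) (E : ℝ) : ENNReal :=
  ENNReal.ofReal (1 / (2 * Lam m E * Real.sqrt E))

lemma sum_upd {m : ℕ} (x : Fin m → ℝ) (k : Fin m) (a : ℝ) :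
    ∑ j, Function.update x k a j = ∑ j, x j - x k + a := by
  rw [Finset.sum_update_of_mem (Finset.mem_univ k), ← Finset.erase_eq,
    Finset.sum_erase_eq_sub (Finset.mem_univ k)]
  ring

lemma step_lower {m : ℕ} {E : ℝ} (hm : 1 ≤ m) (hE : 0 < E) (x : Delta m E) (i : Fin m)
    (H : Delta m E → ENNReal) (hH : Measurable H) (I : Set ℝ) (hIm : MeasurableSet I)
    (hI : I ⊆ Ioo (tank m E x) (tank m E x + x.1 i)) (L : ℝ → ENNReal)
    (hL : ∀ a ∈ I, ∀ h : Function.update x.1 i a ∈ simU m E, L a ≤ H ⟨_, h⟩) :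
    cst m E * ∫⁻ a in I, L a ≤ ∫⁻ z, H z ∂ustep m E x := by
  have hxi := x.2.1 i
  set y := tank m E x with hy
  set xi := x.1 i with hxidef
  set φ : ℝ → ℝ := fun u => y + (1 - u ^ 2) * xi with hφ
  have hsub : I ⊆ φ '' Ioo 0 1 := by
    intro a ha
    obtain ⟨h1, h2⟩ := hI ha
    have hw : 0 < (y + xi - a) / xi := div_pos (by linarith) hxi
    have hw1 : (y + xi - a) / xi < 1 := (div_lt_one hxi).2 (by linarith)
    refine ⟨Real.sqrt ((y + xi - a) / xi), ⟨Real.sqrt_pos.2 hw, ?_⟩, ?_⟩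
    · rw [Real.sqrt_lt' one_pos]; simpa using hw1
    · simp only [hφ]
      rw [Real.sq_sqrt hw.le]
      field_simp; ring
  have hinj : InjOn φ (Ioo 0 1) := by
    intro u hu v hv huv
    simp only [hφ] at huv
    have : (1 - u ^ 2) * xi = (1 - v ^ 2) * xi := by linarith
    have := mul_right_cancel₀ hxi.ne' this
    have h2 : u ^ 2 = v ^ 2 := by linarith
    exact (pow_left_inj₀ hu.1.le hv.1.le two_ne_zero).1 h2
  have hder : ∀ u ∈ Ioo (0:ℝ) 1, HasDerivWithinAt φ (-(2 * u) * xi) (Ioo 0 1) u := by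
    intro u _
    have h1 : HasDerivAt (fun u : ℝ => 1 - u ^ 2) (-(2 * u)) u := by
      simpa using (hasDerivAt_pow 2 u).const_sub 1
    exact ((h1.mul_const xi).const_add y).hasDerivWithinAt
  have e1 : ∫⁻ a in I, L a = ∫⁻ a in φ '' Ioo 0 1, I.indicator L a := by
    rw [lintegral_indicator hIm, Measure.restrict_restrict hIm, inter_eq_left.2 hsub]
  have e2 : ∫⁻ a in I, L a ≤ ENNReal.ofReal (2 * xi) * ∫⁻ u, H (Texch m E i u x) ∂unif01 := by
    rw [e1, lintegral_image_eq_lintegral_abs_deriv_mul measurableSet_Ioo hder hinj]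
    rw [← lintegral_const_mul (μ := unif01) (ENNReal.ofReal (2 * xi))
      (show Measurable fun u => H (Texch m E i u x) from hH.comp (texch_meas_u m E i x))]
    refine setLIntegral_mono' measurableSet_Ioo fun u hu => ?_
    gcongr
    · rw [neg_mul, abs_neg, abs_of_pos (mul_pos (by linarith [hu.1]) hxi)]
      nlinarith [hu.2]
    · by_cases hmem : φ u ∈ I
      · rw [indicator_of_mem hmem]
        have hT : T0 m E i u x.1 = Function.update x.1 i (φ u) := rfl
        have := hL (φ u) hmem (hT ▸ T0_mem x.2 hu)
        refine this.trans (le_of_eq ?_)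
        congr 1
        apply Subtype.ext
        exact (texch_coe i hu x).symm
      · rw [indicator_of_notMem hmem]; exact zero_le
  rw [lintegral_ustep m E x H hH]
  refine le_trans ?_ le_add_self
  have e3 : ENNReal.ofReal (Real.sqrt xi) * ∫⁻ u, H (Texch m E i u x) ∂unif01 ≤
      ∑ i, ENNReal.ofReal (Real.sqrt (x.1 i)) * ∫⁻ u, H (Texch m E i u x) ∂unif01 :=
    Finset.single_le_sum (f := fun i => ENNReal.ofReal (Real.sqrt (x.1 i)) *
      ∫⁻ u, H (Texch m E i u x) ∂unif01) (fun _ _ => zero_le) (Finset.mem_univ i)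
  have hΛ := Lam_pos hm hE
  calc cst m E * ∫⁻ a in I, L a
      ≤ cst m E * (ENNReal.ofReal (2 * xi) * ∫⁻ u, H (Texch m E i u x) ∂unif01) := by gcongr
    _ = ENNReal.ofReal (1 / (2 * Lam m E * Real.sqrt E) * (2 * xi)) *
        ∫⁻ u, H (Texch m E i u x) ∂unif01 := by
        rw [← mul_assoc, cst, ← ENNReal.ofReal_mul (by positivity)]
    _ ≤ ENNReal.ofReal ((Lam m E)⁻¹ * Real.sqrt xi) * ∫⁻ u, H (Texch m E i u x) ∂unif01 := by
        refine mul_le_mul_left (ENNReal.ofReal_le_ofReal ?_) _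
        have hs : Real.sqrt xi ≤ Real.sqrt E := Real.sqrt_le_sqrt (x_lt x i).le
        have hsE : 0 < Real.sqrt E := Real.sqrt_pos.2 hE
        have hsx : 0 < Real.sqrt xi := Real.sqrt_pos.2 hxi
        have hxx : xi = Real.sqrt xi * Real.sqrt xi := (Real.mul_self_sqrt hxi.le).symm
        have : 1 / (2 * Lam m E * Real.sqrt E) * (2 * xi) = (Lam m E)⁻¹ * (xi / Real.sqrt E) := by
          field_simp
        rw [this]
        gcongr
        rw [div_le_iff₀ hsE]
        nlinarith
    _ = (ENNReal.ofReal (Lam m E))⁻¹ * (ENNReal.ofReal (Real.sqrt xi) *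
          ∫⁻ u, H (Texch m E i u x) ∂unif01) := by
        rw [ENNReal.ofReal_mul (by positivity), ENNReal.ofReal_inv_of_pos hΛ, mul_assoc]
    _ ≤ _ := by gcongr

lemma step_lower0 {m : ℕ} {E : ℝ} (hm : 1 ≤ m) (hE : 0 < E) (x : Delta m E) (i : Fin m)
    (H : Delta m E → ENNReal) (hH : Measurable H) (η : ℝ) (hη : η ≤ x.1 i) (L : ℝ → ENNReal)
    (hL : ∀ w ∈ Ioo 0 η, ∀ h : Function.update x.1 i (tank m E x + x.1 i - w) ∈ simU m E,
      L w ≤ H ⟨_, h⟩) :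
    cst m E * ∫⁻ w in Ioo 0 η, L w ≤ ∫⁻ z, H z ∂ustep m E x := by
  set s := tank m E x + x.1 i with hs
  have h := step_lower hm hE x i H hH (Ioo (s - η) s) measurableSet_Ioo
    (fun a ha => ⟨by linarith [ha.1], ha.2⟩) (fun a => L (s - a)) (by
      intro a ha hmem
      have := hL (s - a) ⟨by linarith [ha.2], by linarith [ha.1]⟩ (by simpa using hmem)
      simpa using this)
  refine le_trans (le_of_eq ?_) h
  congr 1
  rw [← lintegral_indicator measurableSet_Ioo, ← lintegral_indicator measurableSet_Ioo,
    ← lintegral_sub_left_eq_self _ s]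
  congr 1
  funext a
  simp only [indicator, mem_Ioo]
  have : (0 < s - a ∧ s - a < η) ↔ (s - η < a ∧ a < s) :=
    ⟨fun h => ⟨by linarith [h.2], by linarith [h.1]⟩, fun h => ⟨by linarith [h.2], by linarith [h.1]⟩⟩
  simp only [this]

noncomputable def mueta {m : ℕ} (i0 : Fin m) (η : ℝ) (i : Fin m) : Measure ℝ :=
  volume.restrict (Ioo (if i = i0 then 0 else η) (if i = i0 then η else 2 * η))

instance mueta_sf {m : ℕ} (i0 : Fin m) (η : ℝ) (i : Fin m) : SigmaFinite (mueta i0 η i) := by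
  unfold mueta; infer_instance

noncomputable def swp {m : ℕ} (E : ℝ) (i0 : Fin m) (v : Fin m → ℝ) : Fin m → ℝ :=
  Function.update v i0 (E - ∑ j, v j)

lemma swp_meas {m : ℕ} (E : ℝ) (i0 : Fin m) : Measurable (swp E i0) := by
  refine measurable_pi_lambda _ fun j => ?_
  by_cases hj : j = i0
  · subst hj
    simp only [swp, Function.update_self]
    fun_prop
  · simp only [swp, Function.update_of_ne hj]
    fun_prop

lemma minor_ind {m : ℕ} {E : ℝ} (hm : 1 ≤ m) (hE : 0 < E) (i0 : Fin m) (η : ℝ) (hη : 0 < η)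
    (F : (Fin m → ℝ) → ENNReal) (hF : Measurable F) (s : Finset (Fin m)) :
    i0 ∉ s → ∀ x : Delta m E, tank m E x < η → 4 * η ≤ x.1 i0 → (∀ k ∈ s, 4 * η ≤ x.1 k) →
      cst m E ^ (2 * s.card + 1) * ENNReal.ofReal η ^ s.card *
        (lmarginal (mueta i0 η) (insert i0 s) (F ∘ swp E i0)) x.1 ≤
      ∫⁻ z, F z.1 ∂ustepIter m E (2 * s.card + 1) x := by
  have hFv : Measurable fun z : Delta m E => F z.1 := hF.comp measurable_subtype_coe
  have hG : Measurable (F ∘ swp E i0) := hF.comp (swp_meas E i0)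
  induction s using Finset.induction_on with
  | empty =>
    intro _ x _ hx0 _
    simp only [Finset.card_empty, mul_zero, zero_add, pow_one, pow_zero, mul_one, ustepIter_one]
    have : insert i0 (∅ : Finset (Fin m)) = {i0} := rfl
    rw [this, lmarginal_singleton]
    simp only [mueta, if_true]
    apply step_lower0 hm hE x i0 _ hFv η (by linarith)
    intro w _ _
    apply le_of_eq
    simp only [Function.comp, swp, Function.update_idem, sum_upd, tank]
    congr 2
    ring
  | insert k s hk ih =>
    intro hi0 x htank hx0 hxs
    have hki : k ≠ i0 := fun h => hi0 (h ▸ Finset.mem_insert_self k s)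
    have hi0s : i0 ∉ s := fun h => hi0 (Finset.mem_insert_of_mem h)
    have ih' := ih hi0s
    set c := s.card with hc
    rw [Finset.card_insert_of_notMem hk, ← hc]
    have e1 : 2 * (c + 1) + 1 = (2 * c + 1) + 1 + 1 := by ring
    rw [e1, lintegral_succ _ _ _ _ _ hFv]
    simp_rw [lintegral_succ m E (2 * c + 1) _ _ hFv]
    have hH1 := lintegral_meas m E (2 * c + 1) _ hFv
    have hH2 : Measurable fun y => ∫⁻ y', ∫⁻ z, F z.1 ∂ustepIter m E (2 * c + 1) y' ∂ustep m E y :=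
      (Measure.measurable_lintegral hH1).comp (ustep_meas m E)
    have hxk : 4 * η ≤ x.1 k := hxs k (Finset.mem_insert_self k s)
    have hstep := step_lower hm hE x k _ hH2 (Ioo η (2 * η)) measurableSet_Ioo
      (fun a ha => ⟨by linarith [ha.1], by linarith [ha.2, tank_pos x]⟩)
      (fun a => cst m E * (cst m E ^ (2 * c + 1) * ENNReal.ofReal η ^ c *
        (lmarginal (mueta i0 η) (insert i0 s) (F ∘ swp E i0)) (Function.update x.1 k a)
          * ENNReal.ofReal η)) (by
        intro a ha hmem
        set x' : Delta m E := ⟨Function.update x.1 k a, hmem⟩ with hx'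
        have hx'0 : x'.1 i0 = x.1 i0 := Function.update_of_ne hki.symm _ _
        have htk : tank m E x' = tank m E x + x.1 k - a := by
          simp only [tank, hx', sum_upd]; ring
        have h0 := step_lower0 hm hE x' i0 _ hH1 η (by rw [hx'0]; linarith)
          (fun _ => cst m E ^ (2 * c + 1) * ENNReal.ofReal η ^ c *
            (lmarginal (mueta i0 η) (insert i0 s) (F ∘ swp E i0)) x'.1) (by
            intro w hw hmem'
            set x'' : Delta m E := ⟨Function.update x'.1 i0 (tank m E x' + x'.1 i0 - w), hmem'⟩
              with hx''
            have hl : lmarginal (mueta i0 η) (insert i0 s) (F ∘ swp E i0) x'.1 =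
                lmarginal (mueta i0 η) (insert i0 s) (F ∘ swp E i0) x''.1 :=
              (lmarginal_update_of_mem _ (Finset.mem_insert_self i0 s) _ _ _).symm
            rw [hl]
            apply ih' x''
            · have : tank m E x'' = w := by
                have : tank m E x'' = E - (∑ j, x'.1 j - x'.1 i0 + (tank m E x' + x'.1 i0 - w)) := by
                  simp only [tank, hx'', sum_upd]
                rw [this]; simp only [tank]; ring
              rw [this]; exact hw.2
            · have : x''.1 i0 = tank m E x' + x'.1 i0 - w := Function.update_self _ _ _
              rw [this, htk, hx'0]
              linarith [tank_pos x, ha.2, hw.2]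
            · intro j hj
              have hj0 : j ≠ i0 := fun h => hi0s (h ▸ hj)
              have hjk : j ≠ k := fun h => hk (h ▸ hj)
              have : x''.1 j = x.1 j := by
                simp only [hx'', hx']
                rw [Function.update_of_ne hj0, Function.update_of_ne hjk]
              rw [this]
              exact hxs j (Finset.mem_insert_of_mem hj))
        rw [setLIntegral_const, Real.volume_Ioo, sub_zero] at h0
        exact h0)
    refine le_trans (le_of_eq ?_) hstep
    rw [Finset.insert_comm, lmarginal_insert _ hG (by
      simp only [Finset.mem_insert, not_or]; exact ⟨hki, hk⟩)]
    have hlm : Measurable fun a => lmarginal (mueta i0 η) (insert i0 s) (F ∘ swp E i0)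
        (Function.update x.1 k a) :=
      (hG.lmarginal _).comp (measurable_update _)
    rw [lintegral_const_mul _ ((hlm.const_mul _).mul_const _),
      lintegral_mul_const _ (hlm.const_mul _), lintegral_const_mul _ hlm]
    simp only [mueta, if_neg hki]
    ring

theorem minor {m : ℕ} {E : ℝ} (hm : 1 ≤ m) (hE : 0 < E) (r : ℝ) (hr : 0 < r) :
    ∃ N : ℕ, 1 ≤ N ∧ ∃ ν : Measure (Delta m E), ∃ ε : ℝ, 0 < ε ∧
      ∀ x : Delta m E, (∀ i, r ≤ x.1 i) → ν ≤ ustepIter m E N x ∧ ε ≤ (ν univ).toReal := by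
  set i0 : Fin m := ⟨0, hm⟩
  set η := r / 8 with hη
  have hηpos : 0 < η := by positivity
  set s : Finset (Fin m) := Finset.univ.erase i0 with hs
  have hins : insert i0 s = Finset.univ := Finset.insert_erase (Finset.mem_univ i0)
  set C : ENNReal := cst m E * (cst m E ^ (2 * s.card + 1) * ENNReal.ofReal η ^ s.card
    * ENNReal.ofReal η) with hC
  have hcst0 : cst m E ≠ 0 := by
    have := Lam_pos hm hE
    rw [cst, ne_eq, ENNReal.ofReal_eq_zero, not_le]; positivity
  have hcstT : cst m E ≠ ⊤ := ENNReal.ofReal_ne_top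
  have hη0 : ENNReal.ofReal η ≠ 0 := by rw [ne_eq, ENNReal.ofReal_eq_zero, not_le]; exact hηpos
  have hC0 : C ≠ 0 := by
    simp only [hC, ne_eq, mul_eq_zero, pow_eq_zero_iff', hcst0, hη0]; simp
  have hCT : C ≠ ⊤ := by
    refine ENNReal.mul_ne_top hcstT (ENNReal.mul_ne_top (ENNReal.mul_ne_top ?_ ?_) ?_)
    · exact ENNReal.pow_ne_top hcstT
    · exact ENNReal.pow_ne_top ENNReal.ofReal_ne_top
    · exact ENNReal.ofReal_ne_top
  set ν0 : Measure (Fin m → ℝ) := C • Measure.map (swp E i0) (Measure.pi (mueta i0 η)) with hν0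
  have key : ∀ x : Delta m E, (∀ i, r ≤ x.1 i) → ∀ A : Set (Fin m → ℝ), MeasurableSet A →
      ν0 A ≤ ustepIter m E (2 * s.card + 1 + 1) x (Subtype.val ⁻¹' A) := by
    intro x hx A hA
    set F : (Fin m → ℝ) → ENNReal := A.indicator 1 with hF
    have hFm : Measurable F := measurable_one.indicator hA
    have hFv : Measurable fun z : Delta m E => F z.1 := hFm.comp measurable_subtype_coe
    have e1 : ustepIter m E (2 * s.card + 1 + 1) x (Subtype.val ⁻¹' A) =
        ∫⁻ z, F z.1 ∂ustepIter m E (2 * s.card + 1 + 1) x := by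
      rw [← lintegral_indicator_one (measurable_subtype_coe hA)]
      rfl
    have e2 : ν0 A = C * ∫⁻ v, (F ∘ swp E i0) v ∂Measure.pi (mueta i0 η) := by
      rw [hν0, Measure.smul_apply, smul_eq_mul, Measure.map_apply (swp_meas E i0) hA,
        ← lintegral_indicator_one (swp_meas E i0 hA)]
      rfl
    rw [e1, e2, lintegral_succ _ _ _ _ _ hFv]
    have h0 := step_lower0 hm hE x i0 _ (lintegral_meas m E (2 * s.card + 1) _ hFv) η
      (by linarith [hx i0])
      (fun _ => cst m E ^ (2 * s.card + 1) * ENNReal.ofReal η ^ s.card *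
        ∫⁻ v, (F ∘ swp E i0) v ∂Measure.pi (mueta i0 η)) (by
        intro w hw hmem
        set x' : Delta m E := ⟨Function.update x.1 i0 (tank m E x + x.1 i0 - w), hmem⟩ with hx'
        have h := minor_ind hm hE i0 η hηpos F hFm s (Finset.notMem_erase i0 _) x' (by
            have : tank m E x' = w := by
              have : tank m E x' = E - (∑ j, x.1 j - x.1 i0 + (tank m E x + x.1 i0 - w)) := by
                simp only [tank, hx', sum_upd]
              rw [this]; simp only [tank]; ring
            rw [this]; exact hw.2) (by
            have : x'.1 i0 = tank m E x + x.1 i0 - w := by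
              simp only [hx', Function.update_self]
            rw [this]
            linarith [tank_pos x, hx i0, hw.2]) (by
            intro j hj
            have hj0 : j ≠ i0 := Finset.ne_of_mem_erase hj
            have : x'.1 j = x.1 j := Function.update_of_ne hj0 _ _
            rw [this, hη]; linarith [hx j])
        rw [hins, lmarginal_univ] at h
        exact h)
    rw [setLIntegral_const, Real.volume_Ioo, sub_zero] at h0
    refine le_trans (le_of_eq ?_) h0
    rw [hC]; ring
  refine ⟨2 * s.card + 1 + 1, by omega, Measure.comap Subtype.val ν0,
    (C * ENNReal.ofReal η ^ m).toReal, ?_, ?_⟩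
  · apply ENNReal.toReal_pos
    · exact mul_ne_zero hC0 (pow_ne_zero _ hη0)
    · exact ENNReal.mul_ne_top hCT (ENNReal.pow_ne_top ENNReal.ofReal_ne_top)
  · intro x hx
    have hemb := MeasurableEmbedding.subtype_coe (simU_meas m E)
    have hle : Measure.comap Subtype.val ν0 ≤ ustepIter m E (2 * s.card + 1 + 1) x := by
      refine Measure.le_iff.2 fun A hA => ?_
      rw [hemb.comap_apply]
      refine (key x hx _ (hemb.measurableSet_image.2 hA)).trans (le_of_eq ?_)
      rw [preimage_image_eq _ Subtype.val_injective]
    refine ⟨hle, ?_⟩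
    have := ustepIter_prob hm hE (2 * s.card + 1 + 1) x
    have hfin := isFiniteMeasure_of_le _ hle
    apply ENNReal.toReal_mono (measure_ne_top _ _)
    rw [hemb.comap_apply]
    have h1 : ν0 (simU m E)ᶜ = 0 := by
      have := key x hx _ (simU_meas m E).compl
      have h2 : (Subtype.val ⁻¹' (simU m E)ᶜ : Set (Delta m E)) = ∅ := by
        ext z; simp
      rw [h2, measure_empty] at this
      exact le_antisymm this zero_le
    have h2 : ν0 univ = C * ENNReal.ofReal η ^ m := by
      rw [hν0, Measure.smul_apply, smul_eq_mul, Measure.map_apply (swp_meas E i0) MeasurableSet.univ,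
        preimage_univ, Measure.pi_univ]
      congr 1
      have : ∀ i : Fin m, mueta i0 η i univ = ENNReal.ofReal η := by
        intro i
        simp only [mueta, Measure.restrict_apply_univ, Real.volume_Ioo]
        split_ifs
        · simp
        · congr 1; ring
      simp [this]
    rw [← h2, image_univ, Subtype.range_coe]
    calc ν0 univ ≤ ν0 (simU m E) + ν0 (simU m E)ᶜ := by
          rw [← union_compl_self (simU m E)]; exact measure_union_le _ _
      _ = _ := by rw [h1, add_zero]

end minorization


section driftsec

/-- The Lyapunov function. -/
noncomputable def VV (m : ℕ) (E A b : ℝ) (x : Delta m E) : ℝ :=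
  ∑ i, (x.1 i) ^ (-(2*b)) + A * (tank m E x) ^ (-b)

lemma tank_meas (m : ℕ) (E : ℝ) : Measurable (tank m E) :=
  measurable_const.sub (Finset.measurable_sum _ fun i _ =>
    (measurable_pi_apply i).comp measurable_subtype_coe)

lemma VV_meas (m : ℕ) (E A b : ℝ) : Measurable (VV m E A b) := by
  refine Measurable.add (Finset.measurable_sum _ fun i _ => ?_) ?_
  · exact ((measurable_pi_apply i).comp measurable_subtype_coe).pow_const _
  · exact ((tank_meas m E).pow_const _).const_mul _

lemma VV_nonneg {m : ℕ} {E A b : ℝ} (hA : 0 ≤ A) (x : Delta m E) : 0 ≤ VV m E A b x :=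
  add_nonneg (Finset.sum_nonneg fun i _ => Real.rpow_nonneg (x.2.1 i).le _)
    (mul_nonneg hA (Real.rpow_nonneg (tank_pos x).le _))

lemma ustep_bound {m : ℕ} {E : ℝ} (hm : 1 ≤ m) (hE : 0 < E) (x : Delta m E)
    (V : Delta m E → ℝ) (hV : ∀ z, 0 ≤ V z) (hVm : Measurable V) (G : Fin m → ℝ)
    (hG : ∀ i, 0 ≤ G i)
    (h : ∀ i, ∫⁻ u, ENNReal.ofReal (V (Texch m E i u x)) ∂unif01 ≤ ENNReal.ofReal (G i)) :
    Integrable V (ustep m E x) ∧ ∫ z, V z ∂ustep m E x ≤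
      V x + (Lam m E)⁻¹ * ∑ i, Real.sqrt (x.1 i) * (G i - V x) := by
  have hL := Lam_pos hm hE
  have hjr : 0 ≤ 1 - jumpRate m E x / Lam m E := by
    rw [sub_nonneg, div_le_one hL]; exact jumpRate_le x
  have key : ∫⁻ z, ENNReal.ofReal (V z) ∂ustep m E x ≤
      ENNReal.ofReal (V x + (Lam m E)⁻¹ * ∑ i, Real.sqrt (x.1 i) * (G i - V x)) := by
    rw [lintegral_ustep m E x _ hVm.ennreal_ofReal]
    have e : V x + (Lam m E)⁻¹ * ∑ i, Real.sqrt (x.1 i) * (G i - V x)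
        = (1 - jumpRate m E x / Lam m E) * V x
          + (Lam m E)⁻¹ * ∑ i, Real.sqrt (x.1 i) * G i := by
      simp only [mul_sub, Finset.sum_sub_distrib, ← Finset.sum_mul]
      unfold jumpRate
      ring
    rw [e, ENNReal.ofReal_add (mul_nonneg hjr (hV x))
      (mul_nonneg (inv_nonneg.2 hL.le) (Finset.sum_nonneg fun i _ =>
        mul_nonneg (Real.sqrt_nonneg _) (hG i))), ENNReal.ofReal_mul hjr,
      ENNReal.ofReal_mul (inv_nonneg.2 hL.le), ENNReal.ofReal_inv_of_pos hL,
      ENNReal.ofReal_sum_of_nonneg (fun i _ => mul_nonneg (Real.sqrt_nonneg _) (hG i))]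
    gcongr with i
    rw [ENNReal.ofReal_mul (Real.sqrt_nonneg _)]
    gcongr
    exact h i
  have hint : Integrable V (ustep m E x) :=
    ⟨hVm.aestronglyMeasurable, by
      rw [hasFiniteIntegral_iff_ofReal (Eventually.of_forall hV)]
      exact key.trans_lt ENNReal.ofReal_lt_top⟩
  refine ⟨hint, ?_⟩
  rw [integral_eq_lintegral_of_nonneg_ae (Eventually.of_forall hV) hVm.aestronglyMeasurable]
  refine ENNReal.toReal_le_of_le_ofReal ?_ key
  have hs : ∑ i, Real.sqrt (x.1 i) * (G i - V x)
      = ∑ i, Real.sqrt (x.1 i) * G i - jumpRate m E x * V x := by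
    simp only [mul_sub, Finset.sum_sub_distrib, ← Finset.sum_mul]; rfl
  rw [hs]
  have h1 : 0 ≤ (Lam m E)⁻¹ * ∑ i, Real.sqrt (x.1 i) * G i :=
    mul_nonneg (inv_nonneg.2 hL.le) (Finset.sum_nonneg fun i _ =>
        mul_nonneg (Real.sqrt_nonneg _) (hG i))
  have h2 := mul_nonneg hjr (hV x)
  have : V x + (Lam m E)⁻¹ * (∑ i, Real.sqrt (x.1 i) * G i - jumpRate m E x * V x)
    = (1 - jumpRate m E x / Lam m E) * V x
          + (Lam m E)⁻¹ * ∑ i, Real.sqrt (x.1 i) * G i := by ring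
  rw [this]; exact add_nonneg h2 h1

lemma unif_rpow {a : ℝ} (ha : a < 1) :
    Integrable (fun u : ℝ => u ^ (-a)) unif01 ∧ ∫ u, u ^ (-a) ∂unif01 = 1/(1-a) := by
  have h1 : IntervalIntegrable (fun u : ℝ => u ^ (-a)) volume 0 1 :=
    intervalIntegral.intervalIntegrable_rpow' (by linarith)
  constructor
  · have := (intervalIntegrable_iff_integrableOn_Ioo_of_le zero_le_one).1 h1
    exact this
  · unfold unif01
    rw [← integral_Ioc_eq_integral_Ioo, ← intervalIntegral.integral_of_le zero_le_one,
      integral_rpow (Or.inl (by linarith))]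
    rw [Real.one_rpow, Real.zero_rpow (by linarith)]
    ring_nf

lemma unif_rpow' {a : ℝ} (ha : a < 1) :
    Integrable (fun u : ℝ => (1 - u) ^ (-a)) unif01 ∧ ∫ u, (1 - u) ^ (-a) ∂unif01 = 1/(1-a) := by
  have h1 : IntervalIntegrable (fun u : ℝ => u ^ (-a)) volume 0 1 :=
    intervalIntegral.intervalIntegrable_rpow' (by linarith)
  have h2 : IntervalIntegrable (fun u : ℝ => (1-u) ^ (-a)) volume 0 1 := by
    have := (h1.comp_sub_left 1)
    simp only [sub_zero, sub_self] at this
    exact this.symm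
  constructor
  · exact (intervalIntegrable_iff_integrableOn_Ioo_of_le zero_le_one).1 h2
  · rw [← (unif_rpow ha).2]
    unfold unif01
    rw [← integral_Ioc_eq_integral_Ioo, ← integral_Ioc_eq_integral_Ioo,
      ← intervalIntegral.integral_of_le zero_le_one, ← intervalIntegral.integral_of_le zero_le_one]
    have := intervalIntegral.integral_comp_sub_left (a := 0) (b := 1) (fun u : ℝ => u ^ (-a)) 1
    simpa using this

lemma tank_texch {m : ℕ} {E : ℝ} (i : Fin m) {u : ℝ} (hu : u ∈ Ioo (0:ℝ) 1) (x : Delta m E) :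
    tank m E (Texch m E i u x) = u^2 * x.1 i := by
  unfold tank
  rw [texch_coe i hu x, T0, sum_upd]
  ring

lemma VV_texch {m : ℕ} {E A b : ℝ} (hb : 0 < b) (i : Fin m) {u : ℝ}
    (hu : u ∈ Ioo (0:ℝ) 1) (x : Delta m E) :
    VV m E A b (Texch m E i u x) ≤ (VV m E A b x - (x.1 i)^(-(2*b)) - A * (tank m E x)^(-b))
      + (tank m E x)^(-b) * (x.1 i)^(-b) * (1-u)^(-b) + A * (x.1 i)^(-b) * u^(-(2*b)) := by
  have hx := x.2.1 i
  have hy := tank_pos x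
  obtain ⟨hu0, hu1⟩ := hu
  have h1 : VV m E A b (Texch m E i u x) = (VV m E A b x - (x.1 i)^(-(2*b)) - A * (tank m E x)^(-b))
      + (tank m E x + (1-u^2) * x.1 i)^(-(2*b)) + A * (u^2 * x.1 i)^(-b) := by
    unfold VV
    rw [tank_texch i ⟨hu0, hu1⟩ x, texch_coe i ⟨hu0, hu1⟩ x]
    have : ∀ j, (T0 m E i u x.1 j)^(-(2*b)) =
        Function.update (fun j => (x.1 j)^(-(2*b))) i
          ((tank m E x + (1-u^2) * x.1 i)^(-(2*b))) j := by
      intro j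
      rcases eq_or_ne j i with rfl | hj
      · simp [T0, tank]
      · simp [T0, Function.update_of_ne hj]
    simp only [this]
    rw [sum_upd]; ring
  rw [h1]
  have h2 : (u^2 * x.1 i)^(-b) = (x.1 i)^(-b) * u^(-(2*b)) := by
    rw [Real.mul_rpow (by positivity) hx.le, mul_comm, ← Real.rpow_natCast u 2,
      ← Real.rpow_mul hu0.le]
    congr 2; push_cast; ring
  have h3 : (tank m E x + (1-u^2) * x.1 i)^(-(2*b)) ≤
      (tank m E x)^(-b) * (x.1 i)^(-b) * (1-u)^(-b) := by
    have hs : 0 < tank m E x + (1-u^2) * x.1 i := by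
      have : 0 < 1 - u^2 := by nlinarith
      positivity
    rw [show -(2*b) = -b + -b by ring, Real.rpow_add hs, mul_assoc,
      ← Real.mul_rpow hx.le (by linarith)]
    refine mul_le_mul ?_ ?_ (by positivity) (by positivity)
    · refine Real.rpow_le_rpow_of_nonpos hy ?_ (by linarith)
      have : 0 < 1 - u^2 := by nlinarith
      nlinarith
    · refine Real.rpow_le_rpow_of_nonpos (by nlinarith) ?_ (by linarith)
      have : 0 ≤ (1-u^2) - (1-u) := by nlinarith
      nlinarith
  rw [h2, ← mul_assoc]
  linarith

lemma VV_lint {m : ℕ} {E A b : ℝ} (hb : 0 < b) (hb2 : b < 1/2) (hA : 0 ≤ A) (i : Fin m)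
    (x : Delta m E) : ∃ G : ℝ, 0 ≤ G ∧
    ∫⁻ u, ENNReal.ofReal (VV m E A b (Texch m E i u x)) ∂unif01 ≤ ENNReal.ofReal G ∧
    G - VV m E A b x = - (x.1 i)^(-(2*b)) - A * (tank m E x)^(-b)
      + (tank m E x)^(-b) * (x.1 i)^(-b) * (1/(1-b)) + A * (x.1 i)^(-b) * (1/(1-2*b)) := by
  set g : ℝ → ℝ := fun u => (VV m E A b x - (x.1 i)^(-(2*b)) - A * (tank m E x)^(-b))
      + (tank m E x)^(-b) * (x.1 i)^(-b) * (1-u)^(-b) + A * (x.1 i)^(-b) * u^(-(2*b)) with hg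
  have i1 := (unif_rpow' (a := b) (by linarith))
  have i2 := (unif_rpow (a := 2*b) (by linarith))
  have j0 : Integrable (fun _ : ℝ => VV m E A b x - (x.1 i)^(-(2*b)) - A * (tank m E x)^(-b)) unif01 :=
    integrable_const _
  have j1 := i1.1.const_mul ((tank m E x)^(-b) * (x.1 i)^(-b))
  have j2 := i2.1.const_mul (A * (x.1 i)^(-b))
  have hgi : Integrable g unif01 := (j0.add j1).add j2
  have hae : ∀ᵐ u ∂unif01, VV m E A b (Texch m E i u x) ≤ g u := by
    unfold unif01
    exact (ae_restrict_mem measurableSet_Ioo).mono fun u hu => VV_texch hb i hu x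
  have hg0 : 0 ≤ᵐ[unif01] g := hae.mono fun u hu => (VV_nonneg hA _).trans hu
  refine ⟨∫ u, g u ∂unif01, integral_nonneg_of_ae hg0, ?_, ?_⟩
  · rw [ofReal_integral_eq_lintegral_ofReal hgi hg0]
    exact lintegral_mono_ae (hae.mono fun u hu => ENNReal.ofReal_le_ofReal hu)
  · have : ∫ u, g u ∂unif01 = (VV m E A b x - (x.1 i)^(-(2*b)) - A * (tank m E x)^(-b))
      + (tank m E x)^(-b) * (x.1 i)^(-b) * (1/(1-b)) + A * (x.1 i)^(-b) * (1/(1-2*b)) := by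
      rw [hg]
      rw [integral_add (by exact j0.add j1) j2, integral_add j0 j1, integral_const_mul,
        integral_const_mul, i1.2, i2.2]
      simp
    rw [this]; ring

lemma VV_le_Q {m : ℕ} {E A b : ℝ} (hm : 1 ≤ m) (hE : 0 < E) (hb : 1/4 < b)
    (hA : 0 ≤ A) : ∃ C, 0 < C ∧ ∀ x : Delta m E,
    (VV m E A b x)^(1-1/(4*b)) ≤ C * (∑ i, (x.1 i)^(1/2-2*b) + (tank m E x)^(-b)) := by
  set θ := 1 - 1/(4*b) with hθ
  have hθ0 : 0 < θ := by
    rw [hθ, sub_pos, div_lt_one (by linarith)]; linarith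
  have hθb : (1/2-2*b) * (1/θ) = -(2*b) := by
    have e : θ = (2*b - 1/2)/(2*b) := by rw [hθ]; field_simp; ring
    have h0 : 2*b - 1/2 ≠ 0 := by linarith
    rw [e, one_div_div, ← neg_sub (2*b) (1/2), neg_mul, mul_div_cancel₀ _ h0]
  have hθ1 : θ < 1 := by
    have : 0 < 1/(4*b) := by positivity
    linarith
  set D := E^(b*(1-θ)) with hD
  have hD0 : 0 < D := by positivity
  set C' : ℝ := m + A * D^(1/θ) with hC'
  have hC0 : 0 < C' := by
    have : (0:ℝ) < m := by exact_mod_cast hm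
    positivity
  refine ⟨C'^θ, by positivity, fun x => ?_⟩
  set Q := ∑ i, (x.1 i)^(1/2-2*b) + (tank m E x)^(-b) with hQ
  have hy := tank_pos x
  have hs0 : ∀ i, 0 ≤ (x.1 i)^(1/2-2*b) := fun i => Real.rpow_nonneg (x.2.1 i).le _
  have hy0 : 0 < (tank m E x)^(-b) := by positivity
  have hQ0 : 0 < Q := add_pos_of_nonneg_of_pos (Finset.sum_nonneg fun i _ => hs0 i) hy0
  have h1 : ∀ i, (x.1 i)^(-(2*b)) ≤ Q^(1/θ) := by
    intro i
    rw [← hθb, Real.rpow_mul (x.2.1 i).le]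
    refine Real.rpow_le_rpow (hs0 i) ?_ (by positivity)
    have := Finset.single_le_sum (f := fun i => (x.1 i)^(1/2-2*b)) (fun j _ => hs0 j) (Finset.mem_univ i)
    linarith
  have h2 : (tank m E x)^(-b) ≤ D^(1/θ) * Q^(1/θ) := by
    rw [← Real.mul_rpow hD0.le hQ0.le]
    have e : (tank m E x)^(-b) = ((tank m E x)^(-b*θ))^(1/θ) := by
      rw [← Real.rpow_mul hy.le]; congr 1; field_simp
    rw [e]
    refine Real.rpow_le_rpow (by positivity) ?_ (by positivity)
    have e2 : -b*θ = b*(1-θ) + -b := by ring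
    rw [e2, Real.rpow_add hy]
    refine mul_le_mul ?_ ?_ hy0.le hD0.le
    · exact Real.rpow_le_rpow hy.le (tank_lt x hm).le (mul_nonneg (by linarith) (by linarith))
    · have := Finset.sum_nonneg (s := Finset.univ) fun i _ => hs0 i
      linarith
  have h3 : VV m E A b x ≤ C' * Q^(1/θ) := by
    unfold VV
    have := Finset.sum_le_sum (s := Finset.univ) fun i _ => h1 i
    simp only [Finset.sum_const, Finset.card_univ, Fintype.card_fin, nsmul_eq_mul] at this
    have := mul_le_mul_of_nonneg_left h2 hA
    rw [hC']
    linarith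
  calc (VV m E A b x)^θ ≤ (C' * Q^(1/θ))^θ := Real.rpow_le_rpow (VV_nonneg hA x) h3 hθ0.le
    _ = C'^θ * Q := by
      rw [Real.mul_rpow hC0.le (by positivity), ← Real.rpow_mul hQ0.le]
      rw [one_div, inv_mul_cancel₀ hθ0.ne', Real.rpow_one]

lemma sqrt_sum_le {m : ℕ} {E : ℝ} (x : Delta m E) :
    Real.sqrt (∑ i, x.1 i) ≤ jumpRate m E x := by
  rw [Real.sqrt_le_left (jumpRate_nonneg x)]
  unfold jumpRate
  calc ∑ i, x.1 i = ∑ i, Real.sqrt (x.1 i) ^ 2 :=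
        Finset.sum_congr rfl fun i _ => (Real.sq_sqrt (x.2.1 i).le).symm
    _ ≤ _ := Finset.sum_sq_le_sq_sum_of_nonneg fun i _ => Real.sqrt_nonneg _

lemma drift {m : ℕ} {E b : ℝ} (hm : 1 ≤ m) (hE : 0 < E) (hb : 1/4 < b) (hb2 : b < 1/2) :
    ∃ A c b0 : ℝ, 0 < A ∧ 0 < c ∧ 0 ≤ b0 ∧ ∀ x : Delta m E,
      Integrable (VV m E A b) (ustep m E x) ∧
      ∫ z, VV m E A b z ∂ustep m E x ≤ VV m E A b x - c * (VV m E A b x)^(1-1/(4*b)) + b0 := by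
  have hm0 : (0:ℝ) < m := by exact_mod_cast hm
  set κ := Real.sqrt (E/2) with hκ
  have hκ0 : 0 < κ := Real.sqrt_pos.2 (by linarith)
  set H := E^(1/2-b) with hH
  have hH0 : 0 < H := by positivity
  set A := (2*m*H+1)/κ with hA
  have hA0 : 0 < A := by positivity
  have hAκ : A * κ = 2*m*H+1 := by rw [hA]; field_simp
  obtain ⟨C, hC0, hC⟩ := VV_le_Q (m := m) (A := A) hm hE hb hA0.le
  have hL := Lam_pos hm hE
  have hb3 : 0 < 1 - 2*b := by linarith
  set B := A * κ * (E/2)^(-b) + m * (A * H * (1/(1-2*b))) with hB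
  have hB0 : 0 ≤ B := by positivity
  refine ⟨A, (Lam m E)⁻¹ * C⁻¹, (Lam m E)⁻¹ * B, hA0, by positivity, by positivity, fun x => ?_⟩
  choose G hG0 hG1 hG2 using fun i => VV_lint (m := m) (by linarith : 0 < b) hb2 hA0.le i x
  obtain ⟨hi, hle⟩ := ustep_bound hm hE x (VV m E A b) (VV_nonneg hA0.le) (VV_meas m E A b) G hG0 hG1
  refine ⟨hi, hle.trans ?_⟩
  set Y := (tank m E x)^(-b) with hY
  have hy := tank_pos x
  have hY0 : 0 < Y := by positivity
  set Q := ∑ i, (x.1 i)^(1/2-2*b) + Y with hQ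
  have hterm : ∀ i, Real.sqrt (x.1 i) * (G i - VV m E A b x) ≤
      -(x.1 i)^(1/2-2*b) - A * Y * Real.sqrt (x.1 i) + 2*H*Y + A * H * (1/(1-2*b)) := by
    intro i
    have hx := x.2.1 i
    rw [hG2 i]
    have e1 : Real.sqrt (x.1 i) * (x.1 i)^(-(2*b)) = (x.1 i)^(1/2-2*b) := by
      rw [Real.sqrt_eq_rpow, ← Real.rpow_add hx]; congr 1
    have e2 : Real.sqrt (x.1 i) * (x.1 i)^(-b) ≤ H := by
      rw [Real.sqrt_eq_rpow, ← Real.rpow_add hx]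
      exact Real.rpow_le_rpow hx.le (x_lt x i).le (by linarith)
    have e20 : 0 ≤ Real.sqrt (x.1 i) * (x.1 i)^(-b) := by positivity
    have e3 : 1/(1-b) ≤ 2 := by
      rw [div_le_iff₀ (by linarith)]; linarith
    have e30 : 0 ≤ 1/(1-b) := by
      apply div_nonneg <;> linarith
    have e4 : (Real.sqrt (x.1 i) * (x.1 i)^(-b)) * (1/(1-b)) ≤ H*2 := by gcongr
    have e5 := mul_le_mul_of_nonneg_right e4 hY0.le
    have e6 : A * (Real.sqrt (x.1 i) * (x.1 i)^(-b)) * (1/(1-2*b)) ≤ A * H * (1/(1-2*b)) := by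
      gcongr
    have e7 : Real.sqrt (x.1 i) * (-(x.1 i)^(-(2*b)) - A * Y + Y * (x.1 i)^(-b) * (1/(1-b))
       + A * (x.1 i)^(-b) * (1/(1-2*b))) = -(Real.sqrt (x.1 i) * (x.1 i)^(-(2*b)))
        - A * Y * Real.sqrt (x.1 i) + (Real.sqrt (x.1 i) * (x.1 i)^(-b)) * (1/(1-b)) * Y
        + A * (Real.sqrt (x.1 i) * (x.1 i)^(-b)) * (1/(1-2*b)) := by ring
    rw [e7, e1]
    linarith
  have hsum := Finset.sum_le_sum (s := Finset.univ) fun i _ => hterm i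
  simp only [Finset.sum_add_distrib, Finset.sum_sub_distrib, Finset.sum_neg_distrib,
    ← Finset.mul_sum, Finset.sum_const, Finset.card_univ, Fintype.card_fin, nsmul_eq_mul] at hsum
  change _ ≤ _ - A * Y * jumpRate m E x + _ + _ at hsum
  have hr : κ * Y - κ * (E/2)^(-b) ≤ jumpRate m E x * Y := by
    have p : 0 < (E/2)^(-b) := by positivity
    rcases le_total (tank m E x) (E/2) with h | h
    · have : κ ≤ jumpRate m E x := by
        refine le_trans ?_ (sqrt_sum_le x)
        apply Real.sqrt_le_sqrt
        unfold tank at h; linarith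
      nlinarith [mul_le_mul_of_nonneg_right this hY0.le, mul_pos hκ0 p]
    · have h1 : Y ≤ (E/2)^(-b) :=
        Real.rpow_le_rpow_of_nonpos (by linarith) h (by linarith)
      nlinarith [mul_nonneg (jumpRate_nonneg x) hY0.le, mul_le_mul_of_nonneg_left h1 hκ0.le]
  have hr2 := mul_le_mul_of_nonneg_left hr hA0.le
  have hfin : ∑ i, Real.sqrt (x.1 i) * (G i - VV m E A b x) ≤ -Q + B := by
    refine hsum.trans ?_
    have : A * (κ * Y - κ * (E/2)^(-b)) = (2*m*H+1) * Y - A * κ * (E/2)^(-b) := by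
      rw [← hAκ]; ring
    rw [this] at hr2
    rw [hQ, hB]
    nlinarith
  have hCx := hC x
  have hCQ : C⁻¹ * (VV m E A b x)^(1-1/(4*b)) ≤ Q := by
    rw [inv_mul_le_iff₀ hC0]; exact hCx
  have := mul_le_mul_of_nonneg_left (hfin.trans (by linarith :
    -Q + B ≤ -(C⁻¹ * (VV m E A b x)^(1-1/(4*b))) + B)) (inv_nonneg.2 hL.le)
  linarith

lemma chain_decay {m : ℕ} {E b : ℝ} (hm : 1 ≤ m) (hE : 0 < E) (hb : 1/4 < b) (hb2 : b < 1/2) :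
    ∃ A₀ A B : ℝ, 0 < A₀ ∧ 0 < A ∧ 0 ≤ B ∧ ∀ ζ : Delta m E → ℝ, Measurable ζ →
      (∀ x, |ζ x| ≤ 1) → ∀ n x y, |∫ z, ζ z ∂ustepIter m E n x - ∫ z, ζ z ∂ustepIter m E n y|
        ≤ A * (VV m E A₀ b x + VV m E A₀ b y + B) * ((n:ℝ)+1)^(-(4*b)) := by
  obtain ⟨A₀, c, b0, hA0, hc, hb0, hd⟩ := drift (m := m) hm hE hb hb2
  have := Kn_markov (m := m) hm hE
  have hK1 : ∀ x, Kn m E 1 x = ustep m E x := ustepIter_one m E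
  have hmn : ∀ R, ∃ N, 1 ≤ N ∧ ∃ ν : Measure (Delta m E), ∃ ε, 0 < ε ∧
      ∀ x, VV m E A₀ b x ≤ R → ν ≤ Kn m E N x ∧ ε ≤ (ν univ).toReal := by
    intro R
    obtain ⟨N, hN, ν, ε, hε, hmin⟩ := minor hm hE ((max R 1)^(-(1/(2*b)))) (by positivity)
    refine ⟨N, hN, ν, ε, hε, fun x hx => hmin x fun i => ?_⟩
    have hxi := x.2.1 i
    have h1 : (x.1 i)^(-(2*b)) ≤ max R 1 := by
      refine le_trans ?_ (hx.trans (le_max_left _ _))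
      unfold VV
      have := Finset.single_le_sum (f := fun i => (x.1 i)^(-(2*b)))
        (fun j _ => Real.rpow_nonneg (x.2.1 j).le _) (Finset.mem_univ i)
      have h' := mul_nonneg hA0.le (Real.rpow_nonneg (tank_pos x).le (-b))
      linarith
    have h2 := Real.rpow_le_rpow_of_nonpos (Real.rpow_pos_of_pos hxi _) h1
      (show -(1/(2*b)) ≤ 0 by rw [neg_nonpos]; apply one_div_nonneg.2; linarith)
    rw [← Real.rpow_mul hxi.le, show -(2*b) * -(1/(2*b)) = 1 by field_simp, Real.rpow_one] at h2
    exact h2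
  obtain ⟨A, B, hA, hB, h⟩ := abs_decay (Kn m E) (Kn_add m E) (VV m E A₀ b) (VV_nonneg hA0.le)
    (VV_meas m E A₀ b) (1/(4*b)) c b0 (by rw [div_le_div_iff₀] <;> linarith)
    (by rw [div_lt_one] <;> linarith) hc hb0
    (fun x => by rw [hK1]; exact (hd x).1) (fun x => by rw [hK1]; exact (hd x).2) hmn
  refine ⟨A₀, A, B, hA0, hA, hB, fun ζ h1 h2 n x y => ?_⟩
  have := h ζ h1 h2 n x y
  rw [one_div_one_div] at this
  exact this

end driftsec


section finalsec
open ProbabilityTheory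

/-- Poisson weights. -/
noncomputable def pw (T : ℝ) (n : ℕ) : ℝ := Real.exp (-T) * T ^ n / n.factorial

lemma pw_nonneg {T : ℝ} (hT : 0 ≤ T) (n : ℕ) : 0 ≤ pw T n := by unfold pw; positivity

lemma pw_hasSum (T : ℝ) : HasSum (pw T) 1 := by
  have h := (NormedSpace.expSeries_div_hasSum_exp T).mul_left (Real.exp (-T))
  rw [← Real.exp_eq_exp_ℝ, ← Real.exp_add, neg_add_cancel, Real.exp_zero] at h
  refine h.congr_fun ?_ |> fun h => h
  intro n
  unfold pw; ring

lemma pw_bound {T p : ℝ} (hT : 0 < T) (hp0 : 0 ≤ p) (hp : p ≤ 2) (n : ℕ) :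
    pw T n * ((n:ℝ)+1)^(-p) ≤ T^(-p) * pw T n + 2 * T^(-p) * pw T (n+2) := by
  have hn : (0:ℝ) < (n:ℝ)+1 := by positivity
  have hw := pw_nonneg hT.le n
  have hw2 := pw_nonneg hT.le (n+2)
  have e : pw T (n+2) * (((n:ℝ)+1)*((n:ℝ)+2)) = T^2 * pw T n := by
    unfold pw
    rw [Nat.factorial_succ, Nat.factorial_succ]
    push_cast
    field_simp
    ring
  have hTp : 0 < T^(-p) := by positivity
  rcases le_total T ((n:ℝ)+1) with h | h
  · have : ((n:ℝ)+1)^(-p) ≤ T^(-p) := Real.rpow_le_rpow_of_nonpos hT h (by linarith)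
    have := mul_le_mul_of_nonneg_left this hw
    have : 0 ≤ 2 * T^(-p) * pw T (n+2) := by positivity
    linarith
  · have h1 : ((n:ℝ)+1)^(-p) = ((n:ℝ)+1)^(2-p) * (((n:ℝ)+1)^2)⁻¹ := by
      rw [sub_eq_neg_add, Real.rpow_add hn]
      norm_cast
      field_simp
    have h2 : ((n:ℝ)+1)^(2-p) ≤ T^(2-p) := Real.rpow_le_rpow hn.le h (by linarith)
    have h3 : T^(2-p) = T^(-p) * T^2 := by
      rw [sub_eq_neg_add, Real.rpow_add hT]; norm_cast
    have h4 : T^2 * pw T n * (((n:ℝ)+1)^2)⁻¹ ≤ 2 * pw T (n+2) := by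
      rw [← e, ← div_eq_mul_inv, div_le_iff₀ (by positivity)]
      have : ((n:ℝ)+1)*((n:ℝ)+2) ≤ 2 * ((n:ℝ)+1)^2 := by nlinarith
      nlinarith [mul_le_mul_of_nonneg_left this hw2]
    calc pw T n * ((n:ℝ)+1)^(-p) ≤ pw T n * (T^(2-p) * (((n:ℝ)+1)^2)⁻¹) := by
          rw [h1]; gcongr
      _ = T^(-p) * (T^2 * pw T n * (((n:ℝ)+1)^2)⁻¹) := by rw [h3]; ring
      _ ≤ T^(-p) * (2 * pw T (n+2)) := by gcongr
      _ ≤ _ := by nlinarith [mul_nonneg hTp.le hw]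

lemma pw_shift_le {T : ℝ} (hT : 0 ≤ T) : ∃ S, S ≤ 1 ∧ HasSum (fun n => pw T (n+2)) S := by
  have h := pw_hasSum T
  refine ⟨_, ?_, (hasSum_nat_add_iff' 2).2 h⟩
  have := Finset.sum_nonneg (s := Finset.range 2) fun i _ => pw_nonneg hT i
  linarith

lemma Pt_eq (m : ℕ) (E t : ℝ) (x : Delta m E) : Pt m E t x = Measure.sum (fun n : ℕ =>
    ENNReal.ofReal (pw (Lam m E * t) n) • ustepIter m E n x) := by
  unfold Pt pw
  simp only [neg_mul]

lemma Pt_prob {m : ℕ} {E : ℝ} (hm : 1 ≤ m) (hE : 0 < E) {t : ℝ} (ht : 0 ≤ t) (x : Delta m E) :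
    IsProbabilityMeasure (Pt m E t x) := by
  constructor
  have hT : 0 ≤ Lam m E * t := mul_nonneg (Lam_pos hm hE).le ht
  have := ustepIter_prob (m := m) hm hE
  rw [Pt_eq, Measure.sum_apply _ MeasurableSet.univ]
  simp only [Measure.smul_apply, measure_univ, smul_eq_mul, mul_one]
  rw [← ENNReal.ofReal_tsum_of_nonneg (pw_nonneg hT) (pw_hasSum _).summable, (pw_hasSum _).tsum_eq,
    ENNReal.ofReal_one]

lemma Pt_meas (m : ℕ) (E t : ℝ) : Measurable (Pt m E t) := by
  refine Measure.measurable_of_measurable_coe _ fun s hs => ?_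
  simp only [Pt_eq, Measure.sum_apply _ hs, Measure.smul_apply, smul_eq_mul]
  refine Measurable.tsum fun n => Measurable.const_mul ?_ _
  exact (Measure.measurable_coe hs).comp (ustepIter_meas m E n)

lemma Pt_hasSum {m : ℕ} {E : ℝ} (hm : 1 ≤ m) (hE : 0 < E) {t : ℝ} (ht : 0 ≤ t) (x : Delta m E)
    (ζ : Delta m E → ℝ) (hζ : Measurable ζ) (M : ℝ) (hM : ∀ x, |ζ x| ≤ M) :
    HasSum (fun n => pw (Lam m E * t) n * ∫ z, ζ z ∂ustepIter m E n x) (∫ z, ζ z ∂Pt m E t x) := by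
  have hT : 0 ≤ Lam m E * t := mul_nonneg (Lam_pos hm hE).le ht
  have := Pt_prob hm hE ht x
  have hi : Integrable ζ (Pt m E t x) := aux_integrable _ ζ hζ M hM
  rw [Pt_eq] at hi ⊢
  have h := hasSum_integral_measure hi
  simp only [integral_smul_measure, ENNReal.toReal_ofReal (pw_nonneg hT _), smul_eq_mul] at h
  exact h

lemma Pt_int_le {m : ℕ} {E : ℝ} (hm : 1 ≤ m) (hE : 0 < E) {t : ℝ} (ht : 0 ≤ t) (x : Delta m E)
    (ζ : Delta m E → ℝ) (M : ℝ) (hM : ∀ x, |ζ x| ≤ M) :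
    |∫ z, ζ z ∂Pt m E t x| ≤ M := by
  have := Pt_prob hm hE ht x
  have h := norm_integral_le_of_norm_le_const (μ := Pt m E t x) (f := ζ) (C := M)
    (Eventually.of_forall hM)
  simpa using h

lemma Pt_int_meas {m : ℕ} {E : ℝ} (hm : 1 ≤ m) (hE : 0 < E) {t : ℝ} (ht : 0 ≤ t)
    (ζ : Delta m E → ℝ) (hζ : Measurable ζ) : Measurable fun x => ∫ z, ζ z ∂Pt m E t x := by
  let κ : Kernel (Delta m E) (Delta m E) := ⟨Pt m E t, Pt_meas m E t⟩
  have : IsMarkovKernel κ := ⟨fun x => Pt_prob hm hE ht x⟩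
  exact (StronglyMeasurable.integral_kernel (κ := κ) hζ.stronglyMeasurable).measurable

lemma pt_decay {m : ℕ} {E b : ℝ} (hm : 1 ≤ m) (hE : 0 < E) (hb : 1/4 < b) (hb2 : b < 1/2) :
    ∃ A₀ A B : ℝ, 0 < A₀ ∧ 0 < A ∧ 0 ≤ B ∧ ∀ ζ : Delta m E → ℝ, Measurable ζ →
      (∀ x, |ζ x| ≤ 1) → ∀ t, 0 < t → ∀ x y, |∫ z, ζ z ∂Pt m E t x - ∫ z, ζ z ∂Pt m E t y|
        ≤ A * (VV m E A₀ b x + VV m E A₀ b y + B) * t^(-(4*b)) := by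
  obtain ⟨A₀, A, B, hA0, hA, hB, h⟩ := chain_decay (m := m) hm hE hb hb2
  have hL := Lam_pos hm hE
  refine ⟨A₀, 3 * A * (Lam m E)^(-(4*b)), B, hA0, by positivity, hB, fun ζ hζ h1 t ht x y => ?_⟩
  have hT : 0 < Lam m E * t := by positivity
  set T := Lam m E * t with hTd
  set W := VV m E A₀ b x + VV m E A₀ b y + B with hW
  have hW0 : 0 ≤ W := add_nonneg (add_nonneg (VV_nonneg hA0.le x) (VV_nonneg hA0.le y)) hB
  have hx := Pt_hasSum hm hE ht.le x ζ hζ 1 h1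
  have hy := Pt_hasSum hm hE ht.le y ζ hζ 1 h1
  have hd := hx.sub hy
  obtain ⟨S, hS, hSs⟩ := pw_shift_le hT.le
  have hg := (((pw_hasSum T).mul_left (T^(-(4*b)))).add (hSs.mul_left (2 * T^(-(4*b))))).mul_left (A*W)
  have hb1 := hd.norm_le_of_bounded hg fun n => by
    rw [← mul_sub, Real.norm_eq_abs, abs_mul, abs_of_nonneg (pw_nonneg hT.le n)]
    have k1 := mul_le_mul_of_nonneg_left (h ζ hζ h1 n x y) (pw_nonneg hT.le n)
    have k2 := mul_le_mul_of_nonneg_left (pw_bound hT (by linarith : 0 ≤ 4*b) (by linarith) n)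
      (mul_nonneg hA.le hW0)
    linarith
  rw [Real.norm_eq_abs] at hb1
  refine hb1.trans ?_
  have hTp : 0 < T^(-(4*b)) := by positivity
  have e : T^(-(4*b)) = (Lam m E)^(-(4*b)) * t^(-(4*b)) := Real.mul_rpow hL.le ht.le
  have : A * W * (T^(-(4*b)) * 1 + 2 * T^(-(4*b)) * S) ≤ A * W * (3 * T^(-(4*b))) := by
    apply mul_le_mul_of_nonneg_left _ (mul_nonneg hA.le hW0)
    nlinarith
  refine this.trans (le_of_eq ?_)
  rw [e]; ring

/-- The integrand defining the class of initial measures. -/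
noncomputable def SS (m : ℕ) (E δ : ℝ) (x : Delta m E) : ℝ :=
  ∑ k, (x.1 k) ^ (2*δ - 1) + (tank m E x) ^ (δ - 1/2)

lemma SS_meas (m : ℕ) (E δ : ℝ) : Measurable (SS m E δ) := by
  refine Measurable.add (Finset.measurable_sum _ fun i _ => ?_) ?_
  · exact ((measurable_pi_apply i).comp measurable_subtype_coe).pow_const _
  · exact (tank_meas m E).pow_const _

lemma SS_nonneg {m : ℕ} {E δ : ℝ} (x : Delta m E) : 0 ≤ SS m E δ x :=
  add_nonneg (Finset.sum_nonneg fun i _ => Real.rpow_nonneg (x.2.1 i).le _)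
    (Real.rpow_nonneg (tank_pos x).le _)

lemma VV_le_SS {m : ℕ} {E A δ b s : ℝ} (hA : 0 ≤ A) (hs : 0 < s) (hsb : s * (2*b) = 1 - 2*δ)
    (x : Delta m E) : VV m E A b x ≤ (m + A) * (SS m E δ x)^(1/s) := by
  have h0 : ∀ i, 0 ≤ (x.1 i)^(2*δ-1) := fun i => Real.rpow_nonneg (x.2.1 i).le _
  have hy := tank_pos x
  have hy0 : 0 ≤ (tank m E x)^(δ-1/2) := by positivity
  have h1 : ∀ i, (x.1 i)^(-(2*b)) ≤ (SS m E δ x)^(1/s) := by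
    intro i
    have e : -(2*b) = (2*δ-1) * (1/s) := by
      have : 2*δ - 1 = -(s*(2*b)) := by linarith
      rw [this]; field_simp
    rw [e, Real.rpow_mul (x.2.1 i).le]
    refine Real.rpow_le_rpow (h0 i) ?_ (by positivity)
    have := Finset.single_le_sum (f := fun i => (x.1 i)^(2*δ-1)) (fun j _ => h0 j) (Finset.mem_univ i)
    unfold SS
    linarith
  have h2 : (tank m E x)^(-b) ≤ (SS m E δ x)^(1/s) := by
    have e : -b = (δ-1/2) * (1/s) := by
      have : δ - 1/2 = -(s*b) := by linarith
      rw [this]; field_simp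
    rw [e, Real.rpow_mul hy.le]
    refine Real.rpow_le_rpow hy0 ?_ (by positivity)
    have := Finset.sum_nonneg (s := Finset.univ) fun i _ => h0 i
    unfold SS
    linarith
  unfold VV
  have h3 := Finset.sum_le_sum (s := Finset.univ) fun i _ => h1 i
  simp only [Finset.sum_const, Finset.card_univ, Fintype.card_fin, nsmul_eq_mul] at h3
  have h4 := mul_le_mul_of_nonneg_left h2 hA
  linarith

lemma final_bound {m : ℕ} {E γ : ℝ} (hm : 1 ≤ m) (hE : 0 < E) (hγ : 0 < γ) (hγ2 : γ ≤ 2) :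
    ∃ K : ℝ, 0 ≤ K ∧ ∀ ζ : Delta m E → ℝ, Measurable ζ → (∀ x, |ζ x| ≤ 1) → ∀ t, 0 < t →
      ∀ x y, |∫ z, ζ z ∂Pt m E t x - ∫ z, ζ z ∂Pt m E t y| ≤
        K * t^(-(2-γ/2)) * (SS m E (γ/8) x + 1) + K * t^(-(2-γ/2)) * (SS m E (γ/8) y + 1) := by
  set b := 1/2 - γ/16 with hb
  obtain ⟨A₀, A, B, hA0, hA, hB, h⟩ := pt_decay (m := m) (b := b) hm hE (by linarith) (by linarith)
  have hd : 0 < 1 - γ/8 := by linarith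
  set s := (1-γ/4)/(1-γ/8) with hs
  have hs0 : 0 < s := div_pos (by linarith) hd
  have hs1 : s < 1 := by rw [hs, div_lt_one hd]; linarith
  have hsm : s * (1-γ/8) = 1-γ/4 := by rw [hs, div_mul_cancel₀ _ hd.ne']
  have hsb : s * (2*b) = 1 - 2*(γ/8) := by
    rw [show 2*b = 1-γ/8 by rw [hb]; ring, hsm]; ring
  have hm0 : (0:ℝ) < m := by exact_mod_cast hm
  set M := (m + A₀) + (m + A₀) + B with hM
  have hM0 : 0 < M := by positivity
  refine ⟨2 * (A * M)^s, by positivity, fun ζ hζ h1 t ht x y => ?_⟩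
  have hD := h ζ hζ h1 t ht x y
  set D := |∫ z, ζ z ∂Pt m E t x - ∫ z, ζ z ∂Pt m E t y| with hDd
  have hD0 : 0 ≤ D := abs_nonneg _
  have hD2 : D ≤ 2 := by
    have k1 := abs_le.1 (Pt_int_le hm hE ht.le x ζ 1 h1)
    have k2 := abs_le.1 (Pt_int_le hm hE ht.le y ζ 1 h1)
    rw [hDd, abs_le]; constructor <;> linarith [k1.1, k1.2, k2.1, k2.2]
  have hSx := SS_nonneg (δ := γ/8) x
  have hSy := SS_nonneg (δ := γ/8) y
  set Z := SS m E (γ/8) x + SS m E (γ/8) y + 1 with hZ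
  have hZ1 : 1 ≤ Z := by linarith
  have hZ0 : 0 < Z := by linarith
  have hW : VV m E A₀ b x + VV m E A₀ b y + B ≤ M * Z^(1/s) := by
    have k1 := VV_le_SS hA0.le hs0 hsb x
    have k2 := VV_le_SS hA0.le hs0 hsb y
    have l1 : (SS m E (γ/8) x)^(1/s) ≤ Z^(1/s) :=
      Real.rpow_le_rpow hSx (by linarith) (by positivity)
    have l2 : (SS m E (γ/8) y)^(1/s) ≤ Z^(1/s) :=
      Real.rpow_le_rpow hSy (by linarith) (by positivity)
    have l3 : 1 ≤ Z^(1/s) := Real.one_le_rpow hZ1 (by positivity)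
    have mA : 0 ≤ (m:ℝ) + A₀ := by positivity
    have := mul_le_mul_of_nonneg_left l1 mA
    have := mul_le_mul_of_nonneg_left l2 mA
    have := mul_le_mul_of_nonneg_left l3 hB
    rw [hM]; linarith
  have hD3 : D ≤ A * (M * Z^(1/s)) * t^(-(4*b)) := by
    refine hD.trans ?_
    gcongr
  have hDs : D ^ s ≤ (A * M)^s * Z * t^(-(2-γ/2)) := by
    refine (Real.rpow_le_rpow hD0 hD3 hs0.le).trans (le_of_eq ?_)
    rw [← mul_assoc, Real.mul_rpow (by positivity) (by positivity),
      Real.mul_rpow (by positivity) (by positivity), ← Real.rpow_mul hZ0.le,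
      ← Real.rpow_mul ht.le, one_div, inv_mul_cancel₀ hs0.ne', Real.rpow_one]
    congr 2
    linarith
  have hDp : D ≤ 2 * D^s := by
    rcases hD0.eq_or_lt with h0 | h0
    · rw [← h0]; positivity
    · have : D = D^(1-s) * D^s := by rw [← Real.rpow_add h0]; simp
      have h2 : D^(1-s) ≤ 2 := by
        calc D^(1-s) ≤ 2^(1-s) := Real.rpow_le_rpow hD0 hD2 (by linarith)
          _ ≤ 2^(1:ℝ) := Real.rpow_le_rpow_of_exponent_le (by norm_num) (by linarith)
          _ = 2 := Real.rpow_one 2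
      calc D = D^(1-s) * D^s := this
        _ ≤ 2 * D^s := by gcongr
  have hq : 0 ≤ (A*M)^s * t^(-(2-γ/2)) := by positivity
  calc D ≤ 2 * ((A * M)^s * Z * t^(-(2-γ/2))) := by linarith
    _ = 2 * ((A*M)^s * t^(-(2-γ/2))) * Z := by ring
    _ ≤ 2 * ((A*M)^s * t^(-(2-γ/2))) * (SS m E (γ/8) x + 1 + (SS m E (γ/8) y + 1)) := by
      apply mul_le_mul_of_nonneg_left _ (by positivity)
      linarith
    _ = _ := by ring

lemma cov_bound {X : Type*} [MeasurableSpace X] (μ : Measure X) [IsProbabilityMeasure μ]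
    (f ξ h : X → ℝ) (hf : Measurable f) (hξ : Measurable ξ) (M C c : ℝ)
    (hM : ∀ x, |f x| ≤ M) (hC : ∀ x, |ξ x| ≤ C) (hC0 : 0 ≤ C)
    (hh : Integrable h μ) (hc : ∀ x, |f x - c| ≤ h x) :
    |∫ x, f x * ξ x ∂μ - (∫ x, f x ∂μ) * ∫ x, ξ x ∂μ| ≤ 2 * C * ∫ x, h x ∂μ := by
  have if1 := aux_integrable μ f hf M hM
  have iξ := aux_integrable μ ξ hξ C hC
  have ifξ : Integrable (fun x => f x * ξ x) μ :=
    aux_integrable μ _ (hf.mul hξ) (M * C) fun x => by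
      rw [abs_mul]
      exact mul_le_mul (hM x) (hC x) (abs_nonneg _) ((abs_nonneg _).trans (hM x))
  have e1 : ∫ x, (f x - c) * ξ x ∂μ = ∫ x, f x * ξ x ∂μ - c * ∫ x, ξ x ∂μ := by
    simp only [sub_mul]
    rw [integral_sub ifξ (iξ.const_mul c), integral_const_mul]
  have e2 : ∫ x, (f x - c) ∂μ = ∫ x, f x ∂μ - c := by
    rw [integral_sub if1 (integrable_const c)]; simp
  have e : ∫ x, f x * ξ x ∂μ - (∫ x, f x ∂μ) * ∫ x, ξ x ∂μ
      = ∫ x, (f x - c) * ξ x ∂μ - (∫ x, (f x - c) ∂μ) * ∫ x, ξ x ∂μ := by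
    rw [e1, e2]; ring
  have b1 : ‖∫ x, (f x - c) * ξ x ∂μ‖ ≤ C * ∫ x, h x ∂μ := by
    rw [← integral_const_mul]
    refine norm_integral_le_of_norm_le (hh.const_mul C) (Eventually.of_forall fun x => ?_)
    rw [Real.norm_eq_abs, abs_mul, mul_comm]
    exact mul_le_mul (hC x) (hc x) (abs_nonneg _) hC0
  have b2 : ‖∫ x, (f x - c) ∂μ‖ ≤ ∫ x, h x ∂μ :=
    norm_integral_le_of_norm_le hh (Eventually.of_forall hc)
  rw [Real.norm_eq_abs] at b1 b2
  have b3 : |∫ x, ξ x ∂μ| ≤ C := by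
    simpa using norm_integral_le_of_norm_le_const (μ := μ) (f := ξ) (Eventually.of_forall hC)
  have b4 : |(∫ x, (f x - c) ∂μ) * ∫ x, ξ x ∂μ| ≤ (∫ x, h x ∂μ) * C := by
    rw [abs_mul]; exact mul_le_mul b2 b3 (abs_nonneg _) ((abs_nonneg _).trans b2)
  rw [e]
  have := abs_sub (∫ x, (f x - c) * ξ x ∂μ) ((∫ x, (f x - c) ∂μ) * ∫ x, ξ x ∂μ)
  linarith

lemma corr_bound {m : ℕ} {E γ : ℝ} (hm : 1 ≤ m) (hE : 0 < E) (hγ : 0 < γ)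
    (μ : Measure (Delta m E)) (hμ : memM m E (γ/8) μ)
    (ξ ζ : Delta m E → ℝ) (hξm : Measurable ξ) (hζm : Measurable ζ)
    (hξb : ∃ C : ℝ, ∀ x, |ξ x| ≤ C) (hζb : ∃ C : ℝ, ∀ x, |ζ x| ≤ C) :
    ∃ K e : ℝ, 0 < e ∧ ∀ t, 0 < t →
      |(∫ x, (∫ z, ζ z ∂(Pt m E t x)) * ξ x ∂μ) -
          (∫ x, (∫ z, ζ z ∂(Pt m E t x)) ∂μ) * (∫ x, ξ x ∂μ)| ≤ K * t^(-(2-γ) - e) := by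
  obtain ⟨hp, hfin⟩ := hμ
  obtain ⟨C1, hC1⟩ := hξb
  obtain ⟨C2, hC2⟩ := hζb
  set C := max C1 1 with hC
  have hC0 : 0 < C := lt_max_of_lt_right one_pos
  have hξC : ∀ x, |ξ x| ≤ C := fun x => (hC1 x).trans (le_max_left _ _)
  set F := max C2 1 with hF
  have hF0 : 0 < F := lt_max_of_lt_right one_pos
  have hζF : ∀ x, |ζ x| ≤ F := fun x => (hC2 x).trans (le_max_left _ _)
  rcases le_or_gt γ 2 with hγ2 | hγ2
  · obtain ⟨K, hK0, hK⟩ := final_bound (m := m) hm hE hγ hγ2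
    have hSi : Integrable (fun x => SS m E (γ/8) x + 1) μ := by
      refine Integrable.add ⟨(SS_meas m E _).aestronglyMeasurable, ?_⟩ (integrable_const _)
      rw [hasFiniteIntegral_iff_ofReal (Eventually.of_forall SS_nonneg)]
      exact lt_top_iff_ne_top.2 hfin
    set I := ∫ x, (SS m E (γ/8) x + 1) ∂μ with hI
    refine ⟨2 * C * (F * K * I), γ/2, by positivity, fun t ht => ?_⟩
    have hζ1 : ∀ x, |ζ x / F| ≤ 1 := fun x => by
      rw [abs_div, abs_of_pos hF0, div_le_one hF0]; exact hζF x
    have hdiff := hK (fun x => ζ x / F) (hζm.div_const F) hζ1 t ht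
    have hdiff2 : ∀ x y, |∫ z, ζ z ∂Pt m E t x - ∫ z, ζ z ∂Pt m E t y| ≤
        F * (K * t^(-(2-γ/2))) * (SS m E (γ/8) x + 1)
        + F * (K * t^(-(2-γ/2))) * (SS m E (γ/8) y + 1) := by
      intro x y
      have := hdiff x y
      rw [integral_div, integral_div, ← sub_div, abs_div, abs_of_pos hF0, div_le_iff₀ hF0] at this
      linarith
    obtain ⟨c, hc⟩ := aux_center (fun x => ∫ z, ζ z ∂Pt m E t x) _ hdiff2
    have := cov_bound μ (fun x => ∫ z, ζ z ∂Pt m E t x) ξ _ (Pt_int_meas hm hE ht.le ζ hζm) hξm F C c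
      (fun x => Pt_int_le hm hE ht.le x ζ F hζF) hξC hC0.le
      (hSi.const_mul (F * (K * t^(-(2-γ/2))))) hc
    refine this.trans (le_of_eq ?_)
    rw [integral_const_mul, show -(2-γ) - γ/2 = -(2-γ/2) by ring]
    ring
  · refine ⟨2 * C * F, γ - 2, by linarith, fun t ht => ?_⟩
    have := cov_bound μ (fun x => ∫ z, ζ z ∂Pt m E t x) ξ (fun _ => F)
      (Pt_int_meas hm hE ht.le ζ hζm) hξm F C 0
      (fun x => Pt_int_le hm hE ht.le x ζ F hζF) hξC hC0.le (integrable_const F)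
      (fun x => by simpa using Pt_int_le hm hE ht.le x ζ F hζF)
    refine this.trans (le_of_eq ?_)
    rw [show -(2-γ) - (γ-2) = 0 by ring]
    simp

end finalsec


/-- Theorem 4, polynomial correlation decay. For any `γ > 0`,
`μ ∈ M_{γ/8}`, and bounded Borel `ξ, ζ : Δ → ℝ`,
`|∫ (P^tζ) ξ dμ - ∫ (P^tζ) dμ ∫ ξ dμ| = o(t^{γ-2})` as `t → ∞`. -/
theorem polynomial_correlation_decay (m : ℕ) (hm : 1 ≤ m) (E : ℝ) (hE : 0 < E)
    (γ : ℝ) (hγ : 0 < γ) (μ : Measure (Delta m E)) (hμ : memM m E (γ/8) μ)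
    (ξ ζ : Delta m E → ℝ) (hξm : Measurable ξ) (hζm : Measurable ζ)
    (hξb : ∃ C : ℝ, ∀ x, |ξ x| ≤ C) (hζb : ∃ C : ℝ, ∀ x, |ζ x| ≤ C) :
    Tendsto (fun t : ℝ => t ^ (2 - γ) *
        |(∫ x, (∫ z, ζ z ∂(Pt m E t x)) * ξ x ∂μ) -
          (∫ x, (∫ z, ζ z ∂(Pt m E t x)) ∂μ) * (∫ x, ξ x ∂μ)|)
      atTop (nhds 0) := by
  obtain ⟨K, e, he, h⟩ := corr_bound hm hE hγ μ hμ ξ ζ hξm hζm hξb hζb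
  have hlim : Tendsto (fun t : ℝ => K * t ^ (-e)) atTop (nhds 0) := by
    simpa using (tendsto_rpow_neg_atTop he).const_mul K
  refine squeeze_zero' ?_ ?_ hlim
  · filter_upwards [eventually_gt_atTop (0:ℝ)] with t ht
    positivity
  · filter_upwards [eventually_gt_atTop (0:ℝ)] with t ht
    refine (mul_le_mul_of_nonneg_left (h t ht) (by positivity)).trans (le_of_eq ?_)
    rw [mul_left_comm, ← Real.rpow_add ht]
    congr 2
    ring
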